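/- arXiv:0906.4873 — 8 statements merged into one kernel-verified Lean document; each statement's English description precedes it below -/
import Mathlib

section
/- Let I be an ideal in a commutative Noetherian ring S and let g ∈ S be such that (I : g) = (I : g^∞). Then (1) I = (I : g) ∩ (I + ⟨g⟩), and (2) the sets of associated primes Ass(S/(I : g)) and Ass(S/(I + ⟨g⟩)) are disjoint. -/
/-- The saturation `(I : g^∞)`. -/
noncomputable def idealSat {R : Type*} [CommRing R] (I : Ideal R) (g : R) : Ideal R :=
  ⨆ s : ℕ, I.colon (Ideal.span {g ^ s})

theorem mem_colon_span_aux {S : Type*} [CommRing S] (I : Ideal S) (g x : S) :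
    x ∈ I.colon (Ideal.span {g}) ↔ x * g ∈ I := by
  rw [Submodule.mem_colon]
  constructor
  · intro h
    exact h g (Ideal.mem_span_singleton_self g)
  · intro h p hp
    obtain ⟨c, rfl⟩ := Ideal.mem_span_singleton'.1 hp
    have : x • (c * g) = c * (x * g) := by simp only [smul_eq_mul]; ring
    rw [this]
    exact I.mul_mem_left c h

theorem splitting_lemma_for_saturated_quotient
    {S : Type*} [CommRing S] [IsNoetherianRing S] (I : Ideal S) (g : S)
    (h : I.colon (Ideal.span {g}) = idealSat I g) :
    I = I.colon (Ideal.span {g}) ⊓ (I + Ideal.span {g}) ∧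
    associatedPrimes S (S ⧸ I.colon (Ideal.span {g})) ∩
      associatedPrimes S (S ⧸ (I + Ideal.span {g})) = ∅ := by
  have key : ∀ y : S, y * g ^ 2 ∈ I → y * g ∈ I := by
    intro y hy
    rw [← mem_colon_span_aux, h]
    exact le_iSup (fun s : ℕ => I.colon (Ideal.span {g ^ s})) 2
      ((mem_colon_span_aux I (g ^ 2) y).2 hy)
  constructor
  · apply le_antisymm
    · exact le_inf (fun x hx => (mem_colon_span_aux I g x).2 (I.mul_mem_right g hx)) le_sup_left
    · rintro x ⟨hx1, hx2⟩
      have hx1 := (mem_colon_span_aux I g x).1 hx1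
      obtain ⟨a, ha, b, hb, rfl⟩ := Submodule.mem_sup.1 hx2
      obtain ⟨c, rfl⟩ := Ideal.mem_span_singleton'.1 hb
      refine I.add_mem ha (key c ?_)
      have e : c * g ^ 2 = (a + c * g) * g - a * g := by ring
      rw [e]
      exact I.sub_mem hx1 (I.mul_mem_right g ha)
  · rw [Set.eq_empty_iff_forall_notMem]
    rintro P ⟨h1, h2⟩
    have hg : g ∈ P := by
      apply IsAssociatedPrime.annihilator_le h2
      rw [Submodule.annihilator_top, Ideal.annihilator_quotient]
      exact (le_sup_right : Ideal.span {g} ≤ I ⊔ Ideal.span {g}) (Ideal.mem_span_singleton_self g)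
    obtain ⟨hP, x, hx⟩ := isAssociatedPrime_iff.1 h1
    obtain ⟨y, rfl⟩ := Ideal.Quotient.mk_surjective x
    apply hP.ne_top
    rw [Ideal.eq_top_iff_one]
    rw [hx, Submodule.mem_colon_singleton] at hg ⊢
    rw [one_smul]
    rw [Submodule.mem_bot] at hg ⊢
    have hg' : Ideal.Quotient.mk (I.colon (Ideal.span {g})) (g * y) = 0 := hg
    rw [Ideal.Quotient.eq_zero_iff_mem, mem_colon_span_aux] at hg' ⊢
    apply key
    have e : y * g ^ 2 = g * y * g := by ring
    rwa [e]
end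

section
/- Let I ⊊ k[x₁,…,xₙ] be a proper binomial ideal that is not cellular. Then there exists a variable xᵢ that is a zerodivisor but not nilpotent modulo I, and for any integer s > 0 such that (I : xᵢ^s) = (I : xᵢ^∞), one has I = (I : xᵢ^s) ∩ (I + ⟨xᵢ^s⟩), where both ideals (I : xᵢ^s) and I + ⟨xᵢ^s⟩ are binomial ideals properly containing I. -/
open MvPolynomial

/-- A binomial is a polynomial with at most two terms. -/
def IsBinomial {k : Type*} [CommSemiring k] {n : ℕ} (f : MvPolynomial (Fin n) k) : Prop :=
  f.support.card ≤ 2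

/-- A binomial ideal is an ideal generated by binomials. -/
def IsBinomialIdeal {k : Type*} [CommSemiring k] {n : ℕ}
    (I : Ideal (MvPolynomial (Fin n) k)) : Prop :=
  ∃ S : Set (MvPolynomial (Fin n) k), (∀ f ∈ S, IsBinomial f) ∧ I = Ideal.span S

/-- A proper binomial ideal is cellular if each variable is either a nonzerodivisor or
nilpotent modulo the ideal. -/
def IsCellular {k : Type*} [CommSemiring k] {n : ℕ}
    (I : Ideal (MvPolynomial (Fin n) k)) : Prop :=
  I ≠ ⊤ ∧ ∀ i : Fin n,
    (∀ f, X i * f ∈ I → f ∈ I) ∨ ∃ m : ℕ, (X i : MvPolynomial (Fin n) k) ^ m ∈ I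

section Aux
variable {k : Type*} [Field k] {n : ℕ}

/-- Two exponents are related if the monomials agree up to a nonzero scalar modulo `I`. -/
def ExpRel (I : Ideal (MvPolynomial (Fin n) k)) (a b : Fin n →₀ ℕ) : Prop :=
  ∃ c : k, c ≠ 0 ∧ monomial a (1 : k) - monomial b c ∈ I

lemma ExpRel.rfl' (I : Ideal (MvPolynomial (Fin n) k)) (a : Fin n →₀ ℕ) : ExpRel I a a :=
  ⟨1, one_ne_zero, by simp⟩

lemma ExpRel.trans' {I : Ideal (MvPolynomial (Fin n) k)} {a b c : Fin n →₀ ℕ}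
    (h : ExpRel I a b) (h' : ExpRel I b c) : ExpRel I a c := by
  obtain ⟨x, hx, h⟩ := h
  obtain ⟨y, hy, h'⟩ := h'
  refine ⟨x * y, mul_ne_zero hx hy, ?_⟩
  have h2 := I.add_mem h (I.mul_mem_left (C x) h')
  rw [mul_sub, C_mul_monomial, C_mul_monomial, mul_one] at h2
  simpa using h2

open Classical in
/-- restriction of a polynomial to the class of `w` -/
noncomputable def clsFilter (I : Ideal (MvPolynomial (Fin n) k)) (w : Fin n →₀ ℕ)
    (f : MvPolynomial (Fin n) k) : MvPolynomial (Fin n) k :=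
  ∑ a ∈ f.support, if ExpRel I w a then monomial a (coeff a f) else 0

open Classical in
lemma coeff_clsFilter (I : Ideal (MvPolynomial (Fin n) k)) (w : Fin n →₀ ℕ)
    (f : MvPolynomial (Fin n) k) (b : Fin n →₀ ℕ) :
    coeff b (clsFilter I w f) = if ExpRel I w b then coeff b f else 0 := by
  unfold clsFilter
  rw [coeff_sum]
  rw [Finset.sum_eq_single b]
  · split_ifs <;> simp
  · intro a _ hab
    split_ifs <;> simp [coeff_monomial, hab]
  · intro hb
    rw [notMem_support_iff] at hb
    simp [hb]

lemma clsFilter_add (I : Ideal (MvPolynomial (Fin n) k)) (w : Fin n →₀ ℕ)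
    (f g : MvPolynomial (Fin n) k) :
    clsFilter I w (f + g) = clsFilter I w f + clsFilter I w g := by
  ext b
  rw [coeff_add, coeff_clsFilter, coeff_clsFilter, coeff_clsFilter]
  split_ifs <;> simp

lemma clsFilter_zero (I : Ideal (MvPolynomial (Fin n) k)) (w : Fin n →₀ ℕ) :
    clsFilter I w (0 : MvPolynomial (Fin n) k) = 0 := by
  simp [clsFilter]

lemma clsFilter_binomial (I : Ideal (MvPolynomial (Fin n) k)) (w : Fin n →₀ ℕ)
    (g : MvPolynomial (Fin n) k) (hg : IsBinomial g) (hI : g ∈ I) : clsFilter I w g ∈ I := by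
  classical
  by_cases h1 : ∀ b ∈ g.support, ExpRel I w b
  · have : clsFilter I w g = g := by
      ext b
      rw [coeff_clsFilter]
      split_ifs with h
      · rfl
      · by_contra hne
        exact h (h1 b (mem_support_iff.2 (Ne.symm hne)))
    rwa [this]
  by_cases h2 : ∀ a ∈ g.support, ¬ ExpRel I w a
  · have : clsFilter I w g = 0 := by
      ext b
      rw [coeff_clsFilter]
      split_ifs with h
      · by_contra hne
        exact h2 b (mem_support_iff.2 (by simpa using hne)) h
      · simp
    rw [this]; exact I.zero_mem
  exfalso
  push Not at h1 h2
  obtain ⟨b, hb, hwb⟩ := h1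
  obtain ⟨a, ha, hwa⟩ := h2
  have hab : a ≠ b := by rintro rfl; exact hwb hwa
  have hs : ({a, b} : Finset (Fin n →₀ ℕ)) = g.support := by
    apply Finset.eq_of_subset_of_card_le
    · intro x hx
      simp only [Finset.mem_insert, Finset.mem_singleton] at hx
      rcases hx with rfl | rfl <;> assumption
    · rw [Finset.card_pair hab]; exact hg
  have hge : g = monomial a (coeff a g) + monomial b (coeff b g) := by
    conv_lhs => rw [g.as_sum, ← hs]
    rw [Finset.sum_pair hab]
  rw [mem_support_iff] at ha hb
  apply hwb
  refine hwa.trans' ⟨-((coeff a g)⁻¹ * coeff b g), neg_ne_zero.2 (mul_ne_zero (inv_ne_zero ha) hb), ?_⟩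
  have h3 := I.mul_mem_left (C (coeff a g)⁻¹) (hge ▸ hI : monomial a (coeff a g) + monomial b (coeff b g) ∈ I)
  rw [mul_add, C_mul_monomial, C_mul_monomial, inv_mul_cancel₀ ha] at h3
  simpa using h3

lemma isBinomial_monomial_mul (v : Fin n →₀ ℕ) (c : k) (g : MvPolynomial (Fin n) k)
    (hg : IsBinomial g) : IsBinomial (monomial v c * g) := by
  classical
  unfold IsBinomial at *
  refine le_trans (Finset.card_le_card (support_mul _ _)) ?_
  refine le_trans (Finset.card_add_le) ?_
  have : (monomial v c).support.card ≤ 1 := by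
    refine le_trans (Finset.card_le_card support_monomial_subset) ?_
    simp
  nlinarith

lemma clsFilter_mem (I : Ideal (MvPolynomial (Fin n) k)) (hbin : IsBinomialIdeal I)
    (w : Fin n →₀ ℕ) (f : MvPolynomial (Fin n) k) (hf : f ∈ I) : clsFilter I w f ∈ I := by
  obtain ⟨S, hS, hIS⟩ := hbin
  have key : ∀ f ∈ Ideal.span S, ∀ r, clsFilter I w (r * f) ∈ I := by
    intro f hf
    induction hf using Submodule.span_induction with
    | mem g hg =>
      intro r
      induction r using MvPolynomial.induction_on' with
      | monomial v c =>
        apply clsFilter_binomial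
        · exact isBinomial_monomial_mul _ _ _ (hS g hg)
        · apply I.mul_mem_left
          rw [hIS]; exact Ideal.subset_span hg
      | add p q hp hq =>
        rw [add_mul, clsFilter_add]; exact I.add_mem hp hq
    | zero => intro r; rw [mul_zero, clsFilter_zero]; exact I.zero_mem
    | add x y _ _ hx hy =>
      intro r
      rw [mul_add, clsFilter_add]; exact I.add_mem (hx r) (hy r)
    | smul a x _ hx =>
      intro r
      rw [smul_eq_mul, ← mul_assoc]; exact hx _
  have := key f (hIS ▸ hf) 1
  rwa [one_mul] at this

lemma isBinomial_monomial (a : Fin n →₀ ℕ) (c : k) : IsBinomial (monomial a c) := by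
  unfold IsBinomial
  refine le_trans (Finset.card_le_card support_monomial_subset) ?_
  simp

lemma isBinomial_sub (a b : Fin n →₀ ℕ) (c d : k) :
    IsBinomial (monomial a c - monomial b d) := by
  classical
  unfold IsBinomial
  refine le_trans (Finset.card_le_card (support_sub _ _ _)) ?_
  refine le_trans (Finset.card_union_le _ _) ?_
  have h1 : (monomial a c).support.card ≤ 1 := by
    refine le_trans (Finset.card_le_card support_monomial_subset) ?_
    simp
  have h2 : (monomial b d).support.card ≤ 1 := by
    refine le_trans (Finset.card_le_card support_monomial_subset) ?_
    simp
  omega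

lemma colon_binomial (I : Ideal (MvPolynomial (Fin n) k)) (hbin : IsBinomialIdeal I)
    (u : Fin n →₀ ℕ) (J : Ideal (MvPolynomial (Fin n) k))
    (hJ : ∀ f, f ∈ J ↔ monomial u (1 : k) * f ∈ I) : IsBinomialIdeal J := by
  classical
  refine ⟨{g | IsBinomial g ∧ g ∈ J}, fun f hf => hf.1, le_antisymm ?_ ?_⟩
  swap
  · rw [Ideal.span_le]; exact fun g hg => hg.2
  have key : ∀ N : ℕ, ∀ f ∈ J, f.support.card ≤ N →
      f ∈ Ideal.span {g | IsBinomial g ∧ g ∈ J} := by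
    intro N
    induction N with
    | zero =>
      intro f _ hN
      have : f = 0 := by simpa using hN
      rw [this]; exact Ideal.zero_mem _
    | succ N ih =>
      intro f hf hN
      by_cases h0 : f = 0
      · rw [h0]; exact Ideal.zero_mem _
      obtain ⟨a, ha⟩ := support_nonempty.2 h0
      -- enough: a binomial with leading coefficient one at `a`
      have fin : ∀ g, IsBinomial g → g ∈ J → coeff a g = 1 → g.support ⊆ f.support →
          f ∈ Ideal.span {g | IsBinomial g ∧ g ∈ J} := by
        intro g hgb hgJ hga hgs
        have hgspan : g ∈ Ideal.span {g | IsBinomial g ∧ g ∈ J} := Ideal.subset_span ⟨hgb, hgJ⟩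
        have h1 : f - C (coeff a f) * g ∈ Ideal.span {g | IsBinomial g ∧ g ∈ J} := by
          apply ih
          · exact J.sub_mem hf (J.mul_mem_left _ hgJ)
          · have hss : (f - C (coeff a f) * g).support ⊆ f.support.erase a := by
              intro b hb
              rw [mem_support_iff, coeff_sub, coeff_C_mul] at hb
              rw [Finset.mem_erase]
              constructor
              · rintro rfl
                simp [hga] at hb
              · by_contra hbf
                have hbg : b ∉ g.support := fun h => hbf (hgs h)
                rw [notMem_support_iff] at hbf hbg
                simp [hbf, hbg] at hb
            have := Finset.card_le_card hss
            rw [Finset.card_erase_of_mem ha] at this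
            omega
        have := Ideal.add_mem _ h1 (Ideal.mul_mem_left _ (C (coeff a f)) hgspan)
        simpa using this
      by_cases hex : ∃ b ∈ f.support, b ≠ a ∧ ExpRel I (u + a) (u + b)
      · obtain ⟨b, hb, hba, c, hc, hcI⟩ := hex
        apply fin (monomial a 1 - monomial b c) (isBinomial_sub _ _ _ _)
        · rw [hJ, mul_sub, monomial_mul, monomial_mul]
          simpa using hcI
        · simp [coeff_monomial, hba]
        · intro x hx
          have := support_sub _ _ _ hx
          rw [Finset.mem_union] at this
          rcases this with h | h <;> have h := support_monomial_subset h <;>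
            rw [Finset.mem_singleton] at h <;> subst h <;> assumption
      · push Not at hex
        apply fin (monomial a 1) (isBinomial_monomial _ _)
        · rw [hJ, monomial_mul]
          have h1 := clsFilter_mem I hbin (u + a) _ ((hJ f).1 hf)
          have h2 : clsFilter I (u + a) (monomial u 1 * f) = monomial (u + a) (coeff a f) := by
            ext b
            rw [coeff_clsFilter, coeff_monomial]
            by_cases hb : u + a = b
            · subst hb
              simp [ExpRel.rfl', coeff_monomial_mul]
            · rw [if_neg hb]
              split_ifs with hr
              · rw [coeff_monomial_mul']
                split_ifs with hub
                · obtain ⟨b', rfl⟩ := exists_add_of_le hub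
                  rw [add_tsub_cancel_left, one_mul]
                  by_contra hne
                  refine hex b' (mem_support_iff.2 hne) ?_ hr
                  rintro rfl; exact hb rfl
                · rfl
              · rfl
          rw [h2] at h1
          have h3 := I.mul_mem_left (C (coeff a f)⁻¹) h1
          rw [C_mul_monomial, inv_mul_cancel₀ (mem_support_iff.1 ha)] at h3
          simpa using h3
        · simp
        · refine support_monomial_subset.trans ?_
          simpa using ha
  exact fun f hf => key _ f hf le_rfl

lemma mem_colon_span {R : Type*} [CommRing R] (I : Ideal R) (g f : R) :
    f ∈ I.colon (Ideal.span {g}) ↔ g * f ∈ I := by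
  rw [Submodule.mem_colon]
  constructor
  · intro h
    have := h g (Ideal.mem_span_singleton_self g)
    rwa [smul_eq_mul, mul_comm] at this
  · intro h p hp
    obtain ⟨r, rfl⟩ := Ideal.mem_span_singleton'.1 hp
    have := I.mul_mem_left r h
    rw [smul_eq_mul]
    convert this using 1
    ring

end Aux

theorem noncellular_splitting_step
    {k : Type*} [Field k] [CharZero k] {n : ℕ}
    (I : Ideal (MvPolynomial (Fin n) k))
    (hbin : IsBinomialIdeal I) (hproper : I ≠ ⊤) (hnotcell : ¬ IsCellular I) :
    ∃ i : Fin n,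
      ((∃ f ∉ I, X i * f ∈ I) ∧ ∀ m : ℕ, (X i : MvPolynomial (Fin n) k) ^ m ∉ I) ∧
      ∀ s : ℕ, 0 < s →
        I.colon (Ideal.span {(X i : MvPolynomial (Fin n) k) ^ s}) = idealSat I (X i) →
          I = I.colon (Ideal.span {(X i : MvPolynomial (Fin n) k) ^ s}) ⊓
                (I + Ideal.span {(X i : MvPolynomial (Fin n) k) ^ s}) ∧
          IsBinomialIdeal (I.colon (Ideal.span {(X i : MvPolynomial (Fin n) k) ^ s})) ∧
          IsBinomialIdeal (I + Ideal.span {(X i : MvPolynomial (Fin n) k) ^ s}) ∧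
          I < I.colon (Ideal.span {(X i : MvPolynomial (Fin n) k) ^ s}) ∧
          I < I + Ideal.span {(X i : MvPolynomial (Fin n) k) ^ s} := by
  have hex : ∃ i : Fin n, (∃ f ∉ I, X i * f ∈ I) ∧
      ∀ m : ℕ, (X i : MvPolynomial (Fin n) k) ^ m ∉ I := by
    by_contra hcon
    apply hnotcell
    refine ⟨hproper, fun i => ?_⟩
    by_contra hi
    push Not at hi
    apply hcon
    obtain ⟨⟨f, hf1, hf2⟩, h2⟩ := hi
    exact ⟨i, ⟨f, hf2, hf1⟩, h2⟩
  obtain ⟨i, hzd, hnil⟩ := hex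
  refine ⟨i, ⟨hzd, hnil⟩, ?_⟩
  intro s hs hsat
  have hle : I ≤ I.colon (Ideal.span {(X i : MvPolynomial (Fin n) k) ^ s}) := by
    intro f hf
    rw [mem_colon_span]
    exact I.mul_mem_left _ hf
  have hle2 : I ≤ I + Ideal.span {(X i : MvPolynomial (Fin n) k) ^ s} := le_sup_left
  refine ⟨le_antisymm (le_inf hle hle2) ?_, ?_, ?_, ?_, ?_⟩
  · rintro f ⟨h1, h2⟩
    have h1 := (mem_colon_span _ _ _).1 h1
    obtain ⟨g, hg, p, hp, rfl⟩ := Submodule.mem_sup.1 h2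
    obtain ⟨r, rfl⟩ := Ideal.mem_span_singleton'.1 hp
    have h3 : (X i : MvPolynomial (Fin n) k) ^ (s + s) * r ∈ I := by
      have := I.sub_mem h1 (I.mul_mem_left (X i ^ s) hg)
      convert this using 1
      ring
    have h4 : r ∈ idealSat I (X i) := by
      unfold idealSat
      exact Submodule.mem_iSup_of_mem (s + s) ((mem_colon_span _ _ _).2 h3)
    rw [← hsat, mem_colon_span] at h4
    refine I.add_mem hg ?_
    rwa [mul_comm]
  · apply colon_binomial I hbin (Finsupp.single i s)
    intro f
    rw [mem_colon_span, X_pow_eq_monomial]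
  · obtain ⟨S, hS, hIS⟩ := hbin
    refine ⟨S ∪ {X i ^ s}, ?_, ?_⟩
    · rintro f (hf | hf)
      · exact hS f hf
      · rw [Set.mem_singleton_iff.1 hf, X_pow_eq_monomial]
        exact isBinomial_monomial _ _
    · rw [Ideal.span_union, ← hIS]; rfl
  · refine lt_of_le_of_ne hle ?_
    intro heq
    obtain ⟨f, hf, hxf⟩ := hzd
    apply hf
    rw [heq, mem_colon_span]
    obtain ⟨t, rfl⟩ := Nat.exists_eq_succ_of_ne_zero hs.ne'
    rw [Nat.succ_eq_add_one, pow_succ, mul_assoc]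
    exact I.mul_mem_left _ hxf
  · refine lt_of_le_of_ne hle2 ?_
    intro heq
    apply hnil s
    rw [heq]
    exact Ideal.mem_sup_right (Ideal.mem_span_singleton_self _)
end

section
/- A proper binomial ideal I ⊊ k[x₁,…,xₙ] is a lattice ideal if and only if I = (I : (∏_{i=1}^n xᵢ)^∞). -/
open MvPolynomial

/-- The monic monomial `x^a` with exponent vector `a`. -/
noncomputable def monomF {k : Type*} [CommSemiring k] {α : Type*} [Finite α]
    (a : α → ℕ) : MvPolynomial α k :=
  monomial (Finsupp.equivFunOnFinite.symm a) 1

/-- The lattice ideal `I₊(σ) = ⟨x^{m⁺} - σ(m)·x^{m⁻} : m ∈ L⟩` of a partial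
character `(L, σ)`. -/
noncomputable def latticeIdeal {k : Type*} [Field k] {α : Type*} [Finite α]
    (L : AddSubgroup (α → ℤ)) (σ : L → kˣ) : Ideal (MvPolynomial α k) :=
  Ideal.span {f | ∃ m : L, f =
    monomF (fun i => ((m : α → ℤ) i).toNat) -
      (σ m : k) • monomF (fun i => (-((m : α → ℤ) i)).toNat)}

/-- An ideal is a lattice ideal if it is `I₊(σ)` for some partial character `(L, σ)`. -/
def IsLatticeIdeal {k : Type*} [Field k] {α : Type*} [Finite α]
    (I : Ideal (MvPolynomial α k)) : Prop :=
  ∃ (L : AddSubgroup (α → ℤ)) (σ : L → kˣ),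
    (∀ a b : L, σ (a + b) = σ a * σ b) ∧ I = latticeIdeal L σ

namespace LatAux

variable {k : Type*} [Field k] {n : ℕ}

/-- exponent vector as an integer vector -/
def Z (u : Fin n →₀ ℕ) : Fin n → ℤ := fun i => (u i : ℤ)

/-- natural vector as a finsupp -/
noncomputable def P (a : Fin n → ℕ) : Fin n →₀ ℕ := Finsupp.equivFunOnFinite.symm a

theorem P_apply (a : Fin n → ℕ) (i : Fin n) : P a i = a i := rfl

theorem Z_add (u v : Fin n →₀ ℕ) : Z (u + v) = Z u + Z v := by
  ext i; simp [Z]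

/-- extension by zero of the character -/
noncomputable def ext0 (L : AddSubgroup (Fin n → ℤ)) (σ : L → kˣ) (m : Fin n → ℤ) : k :=
  open Classical in if h : m ∈ L then (σ ⟨m, h⟩ : k) else 0

theorem ext0_mem {L : AddSubgroup (Fin n → ℤ)} (σ : L → kˣ) (m : L) :
    ext0 L σ m = (σ m : k) := by
  simp [ext0]

theorem ext0_not_mem {L : AddSubgroup (Fin n → ℤ)} (σ : L → kˣ) {m : Fin n → ℤ} (h : m ∉ L) :
    ext0 L σ m = 0 := by
  simp [ext0, h]

theorem ext0_add {L : AddSubgroup (Fin n → ℤ)} (σ : L → kˣ)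
    (hσ : ∀ a b : L, σ (a + b) = σ a * σ b) (m : L) (w : Fin n → ℤ) :
    ext0 L σ (m + w) = σ m * ext0 L σ w := by
  by_cases hw : w ∈ L
  · have h1 := ext0_mem σ (m + ⟨w, hw⟩)
    have h2 := ext0_mem σ ⟨w, hw⟩
    rw [hσ] at h1
    simp only [AddSubgroup.coe_add] at h1 h2
    rw [h1, h2]; simp
  · rw [ext0_not_mem σ hw, ext0_not_mem σ]
    · simp
    · intro h
      exact hw ((AddSubgroup.add_mem_cancel_left L m.2).1 h)

/-- the decomposition of a pair of exponents -/
theorem decomp (u v : Fin n →₀ ℕ) :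
    ∃ t : Fin n →₀ ℕ, u = t + P (fun i => ((Z u - Z v) i).toNat) ∧
      v = t + P (fun i => (-((Z u - Z v) i)).toNat) := by
  refine ⟨P fun i => min (u i) (v i), ?_, ?_⟩ <;> ext i <;>
    simp only [Finsupp.add_apply, P_apply, Z, Pi.sub_apply] <;> omega

theorem mem_lattice {L : AddSubgroup (Fin n → ℤ)} (σ : L → kˣ) (u v : Fin n →₀ ℕ)
    (h : Z u - Z v ∈ L) :
    monomial u (1 : k) - monomial v (ext0 L σ (Z u - Z v)) ∈ latticeIdeal L σ := by
  obtain ⟨t, hu, hv⟩ := decomp u v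
  have hg : (monomF (fun i => ((Z u - Z v) i).toNat) -
      (σ ⟨_, h⟩ : k) • monomF (fun i => (-((Z u - Z v) i)).toNat) : MvPolynomial (Fin n) k)
      ∈ latticeIdeal L σ := Ideal.subset_span ⟨⟨_, h⟩, rfl⟩
  have := Ideal.mul_mem_left _ (monomial t 1) hg
  convert this using 1
  have e := ext0_mem σ ⟨_, h⟩
  simp only at e
  rw [e, mul_sub, monomF, monomF, smul_monomial, monomial_mul, monomial_mul]
  have hu' : t + Finsupp.equivFunOnFinite.symm (fun i => ((Z u - Z v) i).toNat) = u := hu.symm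
  have hv' : t + Finsupp.equivFunOnFinite.symm (fun i => (-((Z u - Z v) i)).toNat) = v := hv.symm
  rw [hu', hv']
  simp

/-- the functional attached to a class -/
noncomputable def phi (L : AddSubgroup (Fin n → ℤ)) (σ : L → kˣ) (w : Fin n → ℤ) :
    MvPolynomial (Fin n) k →ₗ[k] k :=
  (basisMonomials (Fin n) k).constr k (fun u => ext0 L σ (Z u - w))

theorem phi_monomial (L : AddSubgroup (Fin n → ℤ)) (σ : L → kˣ) (w : Fin n → ℤ)
    (u : Fin n →₀ ℕ) (c : k) : phi L σ w (monomial u c) = c * ext0 L σ (Z u - w) := by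
  have h : monomial u c = c • basisMonomials (Fin n) k u := by
    simp [smul_monomial]
  rw [h, map_smul, phi, Module.Basis.constr_basis, smul_eq_mul]

theorem phi_mul (L : AddSubgroup (Fin n → ℤ)) (σ : L → kˣ) (w : Fin n → ℤ)
    (a : Fin n →₀ ℕ) (c : k) (f : MvPolynomial (Fin n) k) :
    phi L σ w (monomial a c * f) = c * phi L σ (w - Z a) f := by
  induction f using MvPolynomial.induction_on' with
  | monomial u d =>
    rw [monomial_mul, phi_monomial, phi_monomial, Z_add, mul_assoc]
    congr 3
    abel
  | add p q hp hq => rw [mul_add, map_add, map_add, hp, hq, mul_add]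

theorem phi_zero {L : AddSubgroup (Fin n → ℤ)} (σ : L → kˣ)
    (hσ : ∀ a b : L, σ (a + b) = σ a * σ b) (f : MvPolynomial (Fin n) k)
    (hf : f ∈ latticeIdeal L σ) : ∀ w, phi L σ w f = 0 := by
  refine Submodule.span_induction (p := fun f _ => ∀ w, phi L σ w f = 0) ?_ ?_ ?_ ?_ hf
  · rintro _ ⟨m, rfl⟩ w
    rw [monomF, monomF, smul_monomial, map_sub, phi_monomial, phi_monomial, smul_eq_mul,
      mul_one, one_mul, ← ext0_add σ hσ, sub_eq_zero]
    congr 1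
    ext i
    simp only [Z, Pi.add_apply, Pi.sub_apply, Finsupp.equivFunOnFinite_symm_apply_apply]
    omega
  · simp
  · intro x y _ _ hx hy w
    rw [map_add, hx, hy, add_zero]
  · intro a x _ hx w
    rw [smul_eq_mul]
    induction a using MvPolynomial.induction_on' generalizing w with
    | monomial u d => rw [phi_mul, hx, mul_zero]
    | add p q hp hq => rw [add_mul, map_add, hp, hq, add_zero]

/-- congruence modulo the lattice -/
def latSetoid (L : AddSubgroup (Fin n → ℤ)) : Setoid (Fin n →₀ ℕ) where
  r u v := Z u - Z v ∈ L
  iseqv :=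
    { refl := fun u => by simp
      symm := fun {u v} h => by simpa using L.neg_mem h
      trans := fun {u v w} h h' => by simpa using L.add_mem h h' }

/-- representative -/
noncomputable def rep (L : AddSubgroup (Fin n → ℤ)) (u : Fin n →₀ ℕ) : Fin n →₀ ℕ :=
  (Quotient.mk (latSetoid L) u).out

theorem rep_rel (L : AddSubgroup (Fin n → ℤ)) (u : Fin n →₀ ℕ) : Z u - Z (rep L u) ∈ L := by
  have h := @Quotient.mk_out _ (latSetoid L) u
  exact (latSetoid L).symm h

theorem rep_eq {L : AddSubgroup (Fin n → ℤ)} {u v : Fin n →₀ ℕ} (h : Z u - Z v ∈ L) :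
    rep L u = rep L v := by
  unfold rep
  rw [Quotient.sound (s := latSetoid L) (a := u) (b := v) h]

theorem rep_rep (L : AddSubgroup (Fin n → ℤ)) (u : Fin n →₀ ℕ) : rep L (rep L u) = rep L u :=
  (rep_eq (rep_rel L u)).symm

/-- normal form -/
noncomputable def nf (L : AddSubgroup (Fin n → ℤ)) (σ : L → kˣ) :
    MvPolynomial (Fin n) k →ₗ[k] MvPolynomial (Fin n) k :=
  (basisMonomials (Fin n) k).constr k
    (fun u => monomial (rep L u) (ext0 L σ (Z u - Z (rep L u))))

theorem nf_monomial (L : AddSubgroup (Fin n → ℤ)) (σ : L → kˣ)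
    (u : Fin n →₀ ℕ) (c : k) : nf L σ (monomial u c) =
      c • monomial (rep L u) (ext0 L σ (Z u - Z (rep L u))) := by
  have h : monomial u c = c • basisMonomials (Fin n) k u := by
    simp [smul_monomial]
  rw [h, map_smul, nf, Module.Basis.constr_basis]

theorem sub_nf (L : AddSubgroup (Fin n → ℤ)) (σ : L → kˣ) (f : MvPolynomial (Fin n) k) :
    f - nf L σ f ∈ latticeIdeal L σ := by
  induction f using MvPolynomial.induction_on' with
  | monomial u c =>
    have := Ideal.mul_mem_left _ (C c) (mem_lattice σ u (rep L u) (rep_rel L u))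
    rw [nf_monomial]
    rw [← smul_eq_C_mul, smul_sub, smul_monomial (σ := Fin n) (a := (1 : k)), smul_eq_mul, mul_one] at this
    exact this
  | add p q hp hq =>
    rw [map_add, add_sub_add_comm]
    exact Ideal.add_mem _ hp hq

theorem coeff_nf (L : AddSubgroup (Fin n → ℤ)) (σ : L → kˣ) (f : MvPolynomial (Fin n) k)
    (v : Fin n →₀ ℕ) : open Classical in
    coeff v (nf L σ f) = if rep L v = v then phi L σ (Z v) f else 0 := by
  classical
  induction f using MvPolynomial.induction_on' with
  | monomial u c =>
    rw [nf_monomial, phi_monomial, coeff_smul, coeff_monomial, smul_eq_mul]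
    by_cases h : rep L u = v
    · subst h
      simp [rep_rep]
    · rw [if_neg h]
      split_ifs with hv
      · rw [ext0_not_mem]
        intro hm
        exact h ((rep_eq hm).trans hv)
      · simp
  | add p q hp hq =>
    rw [map_add, map_add, coeff_add, hp, hq]
    split_ifs <;> simp

theorem mem_iff {L : AddSubgroup (Fin n → ℤ)} (σ : L → kˣ)
    (hσ : ∀ a b : L, σ (a + b) = σ a * σ b) (f : MvPolynomial (Fin n) k) :
    f ∈ latticeIdeal L σ ↔ ∀ w, phi L σ w f = 0 := by
  refine ⟨phi_zero σ hσ f, fun h => ?_⟩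
  have h0 : nf L σ f = 0 := by
    ext v
    rw [coeff_nf, h]
    simp
  simpa [h0] using sub_nf L σ f

theorem prod_pow_eq (s : ℕ) :
    (∏ i : Fin n, (X i : MvPolynomial (Fin n) k)) ^ s = monomial (P fun _ => s) 1 := by
  rw [← Finset.prod_pow, monomial_eq, C_1, one_mul, Finsupp.prod_fintype]
  · rfl
  · simp

theorem mem_colon_iff (I : Ideal (MvPolynomial (Fin n) k)) (g f : MvPolynomial (Fin n) k) :
    f ∈ I.colon (Ideal.span {g} : Ideal (MvPolynomial (Fin n) k)) ↔ g * f ∈ I := by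
  rw [Submodule.mem_colon]
  constructor
  · intro h
    have := h g (Ideal.mem_span_singleton_self g)
    rwa [smul_eq_mul, mul_comm] at this
  · intro h p hp
    obtain ⟨q, rfl⟩ := Ideal.mem_span_singleton.1 hp
    have := I.mul_mem_left q h
    rw [smul_eq_mul]
    convert this using 1
    ring

theorem le_sat (I : Ideal (MvPolynomial (Fin n) k)) (g : MvPolynomial (Fin n) k) (s : ℕ)
    (f : MvPolynomial (Fin n) k) (h : g ^ s * f ∈ I) : f ∈ idealSat I g :=
  (le_iSup (fun s : ℕ => I.colon (Ideal.span {g ^ s} : Ideal (MvPolynomial (Fin n) k))) s)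
    ((mem_colon_iff I _ f).2 h)

theorem lattice_sat {L : AddSubgroup (Fin n → ℤ)} (σ : L → kˣ)
    (hσ : ∀ a b : L, σ (a + b) = σ a * σ b) :
    latticeIdeal L σ = idealSat (latticeIdeal L σ) (∏ i : Fin n, X i) := by
  apply le_antisymm
  · intro f hf
    exact le_sat _ _ 0 f (by simpa using hf)
  · refine iSup_le fun s f hf => ?_
    rw [mem_colon_iff, prod_pow_eq, mem_iff σ hσ] at hf
    rw [mem_iff σ hσ]
    intro w
    have := hf (w + Z (P fun _ => s))
    rw [phi_mul, one_mul] at this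
    simpa using this

theorem cancel {I : Ideal (MvPolynomial (Fin n) k)} (hI : I = idealSat I (∏ i : Fin n, X i))
    (a : Fin n →₀ ℕ) (f : MvPolynomial (Fin n) k) (h : monomial a (1 : k) * f ∈ I) : f ∈ I := by
  rw [hI]
  apply le_sat _ _ (∑ i, a i)
  rw [prod_pow_eq]
  have e : P (fun _ => ∑ i, a i) = P (fun i => ∑ j, a j - a i) + a := by
    ext i
    have := Finset.single_le_sum (f := fun i => a i) (fun _ _ => Nat.zero_le _) (Finset.mem_univ i)
    simp only [P_apply, Finsupp.add_apply] at this ⊢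
    omega
  rw [e, ← mul_one (1 : k), ← monomial_mul, mul_assoc]
  exact I.mul_mem_left _ h

theorem no_mono {I : Ideal (MvPolynomial (Fin n) k)} (hI : I = idealSat I (∏ i : Fin n, X i))
    (hp : I ≠ ⊤) (a : Fin n →₀ ℕ) (c : k) (h : monomial a c ∈ I) : c = 0 := by
  by_contra hc
  apply hp
  rw [Ideal.eq_top_iff_one]
  apply cancel hI a
  have := I.mul_mem_left (C c⁻¹) h
  rwa [C_mul_monomial, inv_mul_cancel₀ hc, ← mul_one (monomial a (1 : k))] at this

/-- the relation defining the lattice -/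
def Rel (I : Ideal (MvPolynomial (Fin n) k)) (m : Fin n → ℤ) (c : k) : Prop :=
  (monomial (P fun i => (m i).toNat) 1 - monomial (P fun i => (-(m i)).toNat) c :
    MvPolynomial (Fin n) k) ∈ I

theorem rel_of {I : Ideal (MvPolynomial (Fin n) k)} (hI : I = idealSat I (∏ i : Fin n, X i))
    (u v : Fin n →₀ ℕ) (c : k) (h : monomial u (1 : k) - monomial v c ∈ I) :
    Rel I (Z u - Z v) c := by
  obtain ⟨t, hu, hv⟩ := decomp u v
  apply cancel hI t
  rwa [mul_sub, monomial_mul, monomial_mul, ← hu, ← hv, one_mul, one_mul]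

theorem Z_P (m : Fin n → ℤ) :
    Z (P fun i => (m i).toNat) - Z (P fun i => (-(m i)).toNat) = m := by
  ext i
  simp only [Z, Pi.sub_apply, P_apply]
  omega

theorem rel_zero {I : Ideal (MvPolynomial (Fin n) k)} : Rel I 0 1 := by
  simp [Rel]

theorem rel_neg {I : Ideal (MvPolynomial (Fin n) k)} (m : Fin n → ℤ) (c : kˣ)
    (h : Rel I m c) : Rel I (-m) (c⁻¹ : kˣ) := by
  unfold Rel at *
  have := I.mul_mem_left (C (-((c⁻¹ : kˣ) : k))) h
  convert this using 1
  rw [mul_sub, C_mul_monomial, C_mul_monomial]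
  simp only [Pi.neg_apply, neg_neg, mul_one, neg_mul, Units.inv_mul, map_neg]
  ring

theorem rel_add {I : Ideal (MvPolynomial (Fin n) k)} (hI : I = idealSat I (∏ i : Fin n, X i))
    (m m' : Fin n → ℤ) (c c' : k) (h : Rel I m c) (h' : Rel I m' c') :
    Rel I (m + m') (c * c') := by
  have := rel_of hI (P (fun i => (m i).toNat) + P (fun i => (m' i).toNat))
    (P (fun i => (-(m i)).toNat) + P (fun i => (-(m' i)).toNat)) (c * c') ?_
  · rw [Z_add, Z_add, add_sub_add_comm, Z_P, Z_P] at this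
    exact this
  · have h1 := I.mul_mem_left (monomial (P fun i => (m' i).toNat) 1) h
    have h2 := I.mul_mem_left (monomial (P fun i => (-(m i)).toNat) c) h'
    have h3 := I.add_mem h1 h2
    convert h3 using 1
    rw [← monomial_mul, ← mul_one (1 : k), ← monomial_mul, mul_one]
    ring

theorem rel_unique {I : Ideal (MvPolynomial (Fin n) k)} (hI : I = idealSat I (∏ i : Fin n, X i))
    (hp : I ≠ ⊤) (m : Fin n → ℤ) (c c' : k) (h : Rel I m c) (h' : Rel I m c') : c = c' := by
  have h3 := I.sub_mem h' h
  rw [sub_sub_sub_cancel_left, ← map_sub] at h3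
  exact sub_eq_zero.1 (no_mono hI hp _ _ h3)

theorem sat_lattice {I : Ideal (MvPolynomial (Fin n) k)} (hbin : IsBinomialIdeal I)
    (hI : I = idealSat I (∏ i : Fin n, X i)) (hp : I ≠ ⊤) : IsLatticeIdeal I := by
  let L : AddSubgroup (Fin n → ℤ) :=
    { carrier := {m | ∃ c : kˣ, Rel I m c}
      zero_mem' := ⟨1, by simpa using rel_zero⟩
      add_mem' := by
        rintro a b ⟨c, hc⟩ ⟨d, hd⟩
        exact ⟨c * d, by simpa using rel_add hI _ _ _ _ hc hd⟩
      neg_mem' := by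
        rintro a ⟨c, hc⟩
        exact ⟨c⁻¹, rel_neg _ _ hc⟩ }
  have hL : ∀ m : L, ∃ c : kˣ, Rel I m c := fun m => m.2
  choose σ hσ using hL
  refine ⟨L, σ, ?_, ?_⟩
  · intro a b
    apply Units.ext
    rw [Units.val_mul]
    exact rel_unique hI hp _ _ _ (hσ (a + b)) (rel_add hI _ _ _ _ (hσ a) (hσ b))
  · apply le_antisymm
    · obtain ⟨S, hS, hIS⟩ := hbin
      have hSI : S ⊆ I := by rw [hIS]; exact Ideal.subset_span
      rw [hIS, Ideal.span_le]
      intro f hf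
      have hfI : f ∈ I := hSI hf
      have hb := hS f hf
      unfold IsBinomial at hb
      have hsum := f.support_sum_monomial_coeff
      interval_cases hcard : f.support.card
      · rw [Finset.card_eq_zero] at hcard
        rw [support_eq_empty.1 hcard]
        exact Ideal.zero_mem _
      · obtain ⟨u, hu⟩ := Finset.card_eq_one.1 hcard
        rw [hu, Finset.sum_singleton] at hsum
        rw [← hsum] at hfI
        have h0 := no_mono hI hp _ _ hfI
        rw [h0, map_zero] at hsum
        rw [← hsum]
        exact Ideal.zero_mem _
      · obtain ⟨u, v, huv, hu⟩ := Finset.card_eq_two.1 hcard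
        have hcu : coeff u f ≠ 0 := mem_support_iff.1 (by simp [hu])
        have hcv : coeff v f ≠ 0 := mem_support_iff.1 (by simp [hu])
        rw [hu, Finset.sum_pair huv] at hsum
        set a := coeff u f
        set b := coeff v f
        have hd : -b / a ≠ 0 := div_ne_zero (neg_ne_zero.2 hcv) hcu
        have hfe : f = C a * (monomial u 1 - monomial v (-b / a)) := by
          rw [mul_sub, C_mul_monomial, C_mul_monomial, mul_div_cancel₀ _ hcu, mul_one, map_neg,
            sub_neg_eq_add, hsum]
        have hin : (monomial u 1 - monomial v (-b / a) : MvPolynomial (Fin n) k) ∈ I := by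
          have := I.mul_mem_left (C a⁻¹) hfI
          rwa [hfe, ← mul_assoc, ← C_mul, inv_mul_cancel₀ hcu, C_1, one_mul] at this
        have hr := rel_of hI _ _ _ hin
        have hmem : Z u - Z v ∈ L := ⟨Units.mk0 _ hd, hr⟩
        have hml := mem_lattice σ u v hmem
        have e := ext0_mem σ ⟨_, hmem⟩
        simp only at e
        rw [e, rel_unique hI hp _ _ _ (hσ ⟨_, hmem⟩) hr] at hml
        rw [hfe]
        exact Ideal.mul_mem_left _ _ hml
    · unfold latticeIdeal
      rw [Ideal.span_le]
      rintro _ ⟨m, rfl⟩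
      have := hσ m
      unfold Rel at this
      rw [monomF, monomF, smul_monomial, smul_eq_mul, mul_one]
      exact this

end LatAux

theorem latticeIdeal_iff_saturated_at_product_of_variables
    {k : Type*} [Field k] [CharZero k] {n : ℕ}
    (I : Ideal (MvPolynomial (Fin n) k))
    (hbin : IsBinomialIdeal I) (hproper : I ≠ ⊤) :
    IsLatticeIdeal I ↔ I = idealSat I (∏ i : Fin n, X i) := by
  constructor
  · rintro ⟨L, σ, hσ, rfl⟩
    exact LatAux.lattice_sat σ hσ
  · intro h
    exact LatAux.sat_lattice hbin h hproper
end

section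
/- Let k be an algebraically closed field of characteristic zero. A lattice ideal I₊(σ) ⊆ k[x₁,…,xₙ] is prime if and only if the partial character (L,σ) is saturated, i.e. L = Sat(L). -/
open MvPolynomial

/-- The integer vector of a natural exponent vector. -/
def zvec {n : ℕ} (a : Fin n →₀ ℕ) : Fin n → ℤ := fun i => (a i : ℤ)

lemma zvec_add {n : ℕ} (a b : Fin n →₀ ℕ) : zvec (a + b) = zvec a + zvec b := by
  ext i; simp [zvec]

lemma zvec_zero {n : ℕ} : zvec (0 : Fin n →₀ ℕ) = 0 := by
  ext i; simp [zvec]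

/-- A partial character into the units of an algebraically closed field extends. -/
lemma exists_ext_char {k : Type*} [Field k] [IsAlgClosed k] {n : ℕ}
    (L : AddSubgroup (Fin n → ℤ)) (σ : L → kˣ)
    (hσ : ∀ a b : L, σ (a + b) = σ a * σ b) :
    ∃ τ : (Fin n → ℤ) → kˣ, (∀ a b, τ (a + b) = τ a * τ b) ∧ ∀ m : L, τ m = σ m := by
  have hs : ∀ {d : ℕ}, d ≠ 0 → Function.Surjective (fun a => a ^ d : kˣ → kˣ) := by
    intro d hd u
    obtain ⟨z, hz⟩ := IsAlgClosed.exists_pow_nat_eq (u : k) (Nat.pos_of_ne_zero hd)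
    have hz0 : z ≠ 0 := by
      rintro rfl
      rw [zero_pow hd] at hz
      exact u.ne_zero hz.symm
    exact ⟨Units.mk0 z hz0, by ext; simpa using hz⟩
  let _ : DivisibleBy (Additive kˣ) ℕ :=
    divisibleByOfSMulRightSurj (Additive kˣ) ℕ (fun {d} hd u => hs hd u)
  let _ : DivisibleBy (Additive kˣ) ℤ := AddGroup.divisibleByIntOfDivisibleByNat _
  obtain ⟨g, hg⟩ := (Module.Baer.of_divisible (Additive kˣ)).extension_property_addMonoidHom
    L.subtype L.subtype_injective
    (AddMonoidHom.mk' (fun m => Additive.ofMul (σ m)) (fun a b => by rw [hσ]; rfl))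
  refine ⟨fun m => (g m).toMul, fun a b => congrArg Additive.toMul (map_add g a b), fun m => ?_⟩
  have := DFunLike.congr_fun hg m
  exact congrArg Additive.toMul this

section
variable {k : Type*} [Field k] {n : ℕ} (L : AddSubgroup (Fin n → ℤ))
  (τ : (Fin n → ℤ) → kˣ) (hτ : ∀ a b, τ (a + b) = τ a * τ b)

/-- The twisted quotient map from the polynomial ring to the group algebra of `ℤ^n / L`. -/
noncomputable def phi : MvPolynomial (Fin n) k →ₐ[k] AddMonoidAlgebra k ((Fin n → ℤ) ⧸ L) :=
  AddMonoidAlgebra.lift k _ (Fin n →₀ ℕ)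
    { toFun := fun a => AddMonoidAlgebra.single
        (QuotientAddGroup.mk (zvec a.toAdd)) (τ (zvec a.toAdd) : k)
      map_one' := by
        have h0 : τ 0 = 1 := by simpa using hτ 0 0
        rw [toAdd_one, zvec_zero, h0]; rfl
      map_mul' := fun a b => by
        rw [toAdd_mul, zvec_add, hτ, AddMonoidAlgebra.single_mul_single]; simp }

lemma phi_monomial (a : Fin n →₀ ℕ) (c : k) : phi L τ hτ (monomial a c) =
    AddMonoidAlgebra.single (QuotientAddGroup.mk (zvec a)) (c * (τ (zvec a) : k)) := by
  unfold phi
  rw [← single_eq_monomial, AddMonoidAlgebra.lift_single]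
  simp

lemma binom_mem (σ : L → kˣ) (hs : ∀ m : L, τ m = σ m) (a b : Fin n →₀ ℕ)
    (h : zvec a - zvec b ∈ L) :
    monomial a (1 : k) - (τ (zvec a - zvec b) : k) • monomial b (1 : k) ∈ latticeIdeal L σ := by
  have hg : _ ∈ latticeIdeal L σ := Ideal.subset_span ⟨⟨_, h⟩, rfl⟩
  have := Ideal.mul_mem_left _ (monomial (a - (a - b)) (1 : k)) hg
  convert this using 1
  rw [mul_sub, mul_smul_comm, ← hs]
  unfold monomF
  have ha : a = a - (a - b) +
      Finsupp.equivFunOnFinite.symm (fun i => ((zvec a - zvec b) i).toNat) := by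
    ext i
    simp [zvec]
  have hb : b = a - (a - b) +
      Finsupp.equivFunOnFinite.symm (fun i => (-((zvec a - zvec b) i)).toNat) := by
    ext i
    simp [zvec]
    omega
  rw [monomial_mul, monomial_mul, mul_one, ← ha, ← hb]

lemma ker_phi (σ : L → kˣ) (hs : ∀ m : L, τ m = σ m) :
    RingHom.ker (phi L τ hτ) = latticeIdeal L σ := by
  apply le_antisymm
  · classical
    let r : (Fin n → ℤ) ⧸ L → MvPolynomial (Fin n) k ⧸ latticeIdeal L σ := fun c =>
      if h : ∃ a : Fin n →₀ ℕ, (QuotientAddGroup.mk (zvec a) : (Fin n → ℤ) ⧸ L) = c then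
        Ideal.Quotient.mk _ (((τ (zvec h.choose))⁻¹ : kˣ) • monomial h.choose (1 : k)) else 0
    let s : AddMonoidAlgebra k ((Fin n → ℤ) ⧸ L) →ₗ[k] MvPolynomial (Fin n) k ⧸ latticeIdeal L σ :=
      (Finsupp.linearCombination k r).comp (AddMonoidAlgebra.coeffLinearEquiv k).toLinearMap
    have hcomp : s.comp (phi L τ hτ).toLinearMap =
        (Ideal.Quotient.mkₐ k (latticeIdeal L σ)).toLinearMap := by
      apply AddMonoidAlgebra.lhom_ext'
      intro a
      apply LinearMap.ext_ring
      have h : ∃ b : Fin n →₀ ℕ, (QuotientAddGroup.mk (zvec b) : (Fin n → ℤ) ⧸ L) =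
        QuotientAddGroup.mk (zvec a) := ⟨a, rfl⟩
      have hL : zvec a - zvec h.choose ∈ L := by
        have := QuotientAddGroup.eq.1 h.choose_spec
        rwa [neg_add_eq_sub] at this
      have hm := binom_mem L τ σ hs a h.choose hL
      have hr : r (QuotientAddGroup.mk (zvec a)) =
        Ideal.Quotient.mk _ (((τ (zvec h.choose))⁻¹ : kˣ) • monomial h.choose (1 : k)) :=
        dif_pos h
      have h1 : s (phi L τ hτ (monomial a 1)) =
          (τ (zvec a) : k) • r (QuotientAddGroup.mk (zvec a)) := by
        rw [phi_monomial]
        simp [s]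
      change s (phi L τ hτ (monomial a 1)) = Ideal.Quotient.mk _ (monomial a 1)
      rw [h1, hr]
      symm
      change _ = Ideal.Quotient.mk _ ((τ (zvec a) : k) • _)
      rw [Ideal.Quotient.eq]
      convert hm using 2
      rw [Units.smul_def, smul_smul]
      congr 1
      have : τ (zvec a) = τ (zvec a - zvec h.choose) * τ (zvec h.choose) := by
        rw [← hτ]; simp
      rw [this]
      simp
    intro f hf
    rw [← Ideal.Quotient.eq_zero_iff_mem]
    have := LinearMap.congr_fun hcomp f
    change s (phi L τ hτ f) = Ideal.Quotient.mk _ f at this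
    rw [← this, (RingHom.mem_ker).1 hf, map_zero]
  · rw [latticeIdeal, Ideal.span_le]
    rintro f ⟨m, rfl⟩
    rw [SetLike.mem_coe, RingHom.mem_ker, map_sub, map_smul, monomF, monomF, phi_monomial,
      phi_monomial, sub_eq_zero, AddMonoidAlgebra.smul_single, AddMonoidAlgebra.single_inj]
    left
    have key : zvec (Finsupp.equivFunOnFinite.symm (fun i => ((m : Fin n → ℤ) i).toNat)) =
        m + zvec (Finsupp.equivFunOnFinite.symm (fun i => (-((m : Fin n → ℤ) i)).toNat)) := by
      ext i
      simp [zvec]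
      omega
    rw [key, hτ, hs]
    constructor
    · rw [QuotientAddGroup.eq]
      simp
    · simp

end

theorem latticeIdeal_isPrime_iff_saturated
    {k : Type*} [Field k] [IsAlgClosed k] [CharZero k] {n : ℕ}
    (L : AddSubgroup (Fin n → ℤ)) (σ : L → kˣ)
    (hσ : ∀ a b : L, σ (a + b) = σ a * σ b) :
    (latticeIdeal L σ).IsPrime ↔
      ∀ m : Fin n → ℤ, m ∈ L ↔ ∃ d : ℤ, d ≠ 0 ∧ d • m ∈ L := by
  obtain ⟨τ, hτ, hs⟩ := exists_ext_char L σ hσ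
  have hker := ker_phi L τ hτ σ hs
  constructor
  · intro hp m
    refine ⟨fun h => ⟨1, one_ne_zero, by simpa using h⟩, ?_⟩
    rintro ⟨d, hd, hdm⟩
    have hN : d.natAbs ≠ 0 := by simpa using hd
    have hdm' : d.natAbs • m ∈ L := by
      rcases Int.natAbs_eq d with h | h
      · rw [h, natCast_zsmul] at hdm; exact hdm
      · rw [h, neg_smul, natCast_zsmul, neg_mem_iff] at hdm; exact hdm
    generalize d.natAbs = N at hN hdm'
    let a : Fin n →₀ ℕ := Finsupp.equivFunOnFinite.symm (fun i => (m i).toNat)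
    let b : Fin n →₀ ℕ := Finsupp.equivFunOnFinite.symm (fun i => (-(m i)).toNat)
    have hab : zvec a = m + zvec b := by
      ext i
      simp [zvec, a, b]
      omega
    let u : MvPolynomial (Fin n) k := monomial a 1
    let v : MvPolynomial (Fin n) k := monomial b (τ m : k)
    have hu : phi L τ hτ u = AddMonoidAlgebra.single (QuotientAddGroup.mk (zvec a))
      (τ (zvec a) : k) := by simp [u, phi_monomial]
    have hv : phi L τ hτ v = AddMonoidAlgebra.single (QuotientAddGroup.mk (zvec b))
      (τ (zvec a) : k) := by simp [v, phi_monomial, hab, hτ]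
    have hmem : (∑ i ∈ Finset.range N, u ^ i * v ^ (N - 1 - i)) * (u - v) ∈ latticeIdeal L σ := by
      rw [(Commute.all u v).geom_sum₂_mul, ← hker, RingHom.mem_ker, map_sub, map_pow, map_pow,
        hu, hv, AddMonoidAlgebra.single_pow, AddMonoidAlgebra.single_pow, sub_eq_zero]
      congr 1
      rw [← QuotientAddGroup.mk_nsmul, ← QuotientAddGroup.mk_nsmul, QuotientAddGroup.eq, hab,
        nsmul_add]
      simpa using hdm'
    rcases hp.mem_or_mem hmem with h | h
    · exfalso
      rw [← hker, RingHom.mem_ker] at h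
      let ε : AddMonoidAlgebra k ((Fin n → ℤ) ⧸ L) →ₐ[k] k := AddMonoidAlgebra.lift k _ _ 1
      have h2 := congrArg ε h
      have hεu : ε (phi L τ hτ u) = τ (zvec a) := by
        rw [hu]; simp only [ε, AddMonoidAlgebra.lift_single]; simp
      have hεv : ε (phi L τ hτ v) = τ (zvec a) := by
        rw [hv]; simp only [ε, AddMonoidAlgebra.lift_single]; simp
      simp only [map_sum, map_mul, map_pow, hεu, hεv, map_zero] at h2
      rw [Finset.sum_congr rfl (g := fun _ => (τ (zvec a) : k) ^ (N - 1))] at h2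
      · simp [hN] at h2
      · intro i hi
        rw [← pow_add]
        congr 1
        have := Finset.mem_range.1 hi
        omega
    · rw [← hker, RingHom.mem_ker, map_sub, hu, hv, sub_eq_zero,
        AddMonoidAlgebra.single_left_inj (Units.ne_zero _), QuotientAddGroup.eq, hab] at h
      simpa using h
  · intro hsat
    have : IsAddTorsionFree ((Fin n → ℤ) ⧸ L) := by
      refine ⟨fun N hN x y hxy => ?_⟩
      induction x using QuotientAddGroup.induction_on with | _ x
      induction y using QuotientAddGroup.induction_on with | _ y
      change N • (QuotientAddGroup.mk x : (Fin n → ℤ) ⧸ L) = N • QuotientAddGroup.mk y at hxy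
      rw [← QuotientAddGroup.mk_nsmul, ← QuotientAddGroup.mk_nsmul, QuotientAddGroup.eq] at hxy
      rw [QuotientAddGroup.eq, hsat]
      refine ⟨N, by exact_mod_cast hN, ?_⟩
      rw [natCast_zsmul, nsmul_add, smul_neg]
      exact hxy
    have : AddMonoid.FG (Fin n → ℤ) :=
      (AddGroup.fg_iff_addMonoid_fg).1 (Module.Finite.iff_addGroup_fg.1 inferInstance)
    have : AddMonoid.FG ((Fin n → ℤ) ⧸ L) :=
      AddMonoid.fg_of_surjective (QuotientAddGroup.mk' L) (QuotientAddGroup.mk'_surjective L)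
    rw [← hker]
    exact RingHom.ker_isPrime _
end

section
/- Let I ⊊ k[x₁,…,xₙ] be a radical cellular binomial ideal with cell indices E. Then there exists a partial character (L,σ) on ℤ^E such that I = M(E) + I₊(σ), where I₊(σ) is regarded as an ideal of k[x₁,…,xₙ] via the inclusion k[E] ⊆ k[x₁,…,xₙ]. -/
open MvPolynomial

/-- `M(E)`, the ideal generated by the variables not in `E`. -/
noncomputable def MIdeal {k : Type*} [CommSemiring k] {n : ℕ} (E : Set (Fin n)) :
    Ideal (MvPolynomial (Fin n) k) :=
  Ideal.span {f | ∃ i ∉ E, f = X i}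

section Helpers

variable {k : Type*} [Field k] {n : ℕ}

/-- The monomial `x^a` of `k[E]`, seen in the full polynomial ring. -/
noncomputable def eMon (k : Type*) [Field k] {n : ℕ} (E : Set (Fin n)) (a : ↥E → ℕ) :
    MvPolynomial (Fin n) k :=
  rename (Subtype.val : ↥E → Fin n) (monomF a)

lemma eMon_add (E : Set (Fin n)) (a b : ↥E → ℕ) :
    eMon k E (a + b) = eMon k E a * eMon k E b := by
  unfold eMon monomF
  rw [← map_mul, monomial_mul, mul_one]
  congr 3
  ext i
  rfl

lemma eMon_zero (E : Set (Fin n)) : eMon k E 0 = 1 := by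
  unfold eMon monomF
  have : (Finsupp.equivFunOnFinite.symm (0 : ↥E → ℕ)) = 0 := by ext; rfl
  rw [this]
  simp

lemma eMon_cancel {I : Ideal (MvPolynomial (Fin n) k)} {E : Set (Fin n)}
    (hE : ∀ i ∈ E, ∀ f, X i * f ∈ I → f ∈ I) (a : ↥E → ℕ) :
    ∀ f, eMon k E a * f ∈ I → f ∈ I := by
  let S : Submonoid (MvPolynomial (Fin n) k) :=
    { carrier := {g | ∀ f, g * f ∈ I → f ∈ I}
      one_mem' := fun f hf => by simpa using hf
      mul_mem' := fun {x y} hx hy f hf => hy f (hx _ (by rwa [← mul_assoc])) }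
  change eMon k E a ∈ S
  unfold eMon monomF
  rw [monomial_eq, map_mul]
  refine S.mul_mem (by simp) ?_
  rw [Finsupp.prod, map_prod]
  refine S.prod_mem fun i _ => ?_
  rw [map_pow, rename_X]
  exact S.pow_mem (hE i.1 i.2) _

lemma monomial_eq_eMon (E : Set (Fin n)) (p : Fin n →₀ ℕ) (hp : ∀ i ∉ E, p i = 0) (u : k) :
    monomial p u = C u * eMon k E (fun i => p i) := by
  unfold eMon monomF
  rw [rename_monomial, C_mul_monomial, mul_one]
  suffices h : p = Finsupp.mapDomain Subtype.val
      (Finsupp.equivFunOnFinite.symm (fun i : ↥E => p i)) from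
    congrArg (fun q => monomial q u) h
  ext i
  by_cases hi : i ∈ E
  · have := Finsupp.mapDomain_apply (Subtype.val_injective (p := fun i => i ∈ E))
      (Finsupp.equivFunOnFinite.symm (fun i : ↥E => p i)) ⟨i, hi⟩
    exact this.symm
  · rw [Finsupp.mapDomain_of_notMem_range _ _ (by simpa using hi), hp i hi]

lemma monomial_mem_MIdeal (E : Set (Fin n)) (p : Fin n →₀ ℕ) (i : Fin n) (hi : i ∉ E)
    (hp : p i ≠ 0) (u : k) : monomial p u ∈ (MIdeal E : Ideal (MvPolynomial (Fin n) k)) := by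
  have h : (X i : MvPolynomial (Fin n) k) ∈ (MIdeal E : Ideal (MvPolynomial (Fin n) k)) :=
    Ideal.subset_span ⟨i, hi, rfl⟩
  refine Ideal.mem_of_dvd _ ?_ h
  exact X_dvd_monomial.2 (Or.inr hp)

lemma binomial_form {f : MvPolynomial (Fin n) k} (hf : IsBinomial f) :
    ∃ p q u v, f = monomial p u + monomial q v := by
  classical
  have hs := f.as_sum
  unfold IsBinomial at hf
  interval_cases h : f.support.card
  · rw [Finset.card_eq_zero] at h
    exact ⟨0, 0, 0, 0, by rw [hs, h]; simp⟩
  · obtain ⟨p, hp⟩ := Finset.card_eq_one.1 h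
    exact ⟨p, 0, f.coeff p, 0, by
      conv_lhs => rw [hs, hp]
      simp⟩
  · obtain ⟨p, q, hpq, hp⟩ := Finset.card_eq_two.1 h
    exact ⟨p, q, f.coeff p, f.coeff q, by
      conv_lhs => rw [hs, hp]
      rw [Finset.sum_pair hpq]⟩

/-- The binomial `x^a - c x^b`. -/
noncomputable def eBin (E : Set (Fin n)) (a b : ↥E → ℕ) (c : k) : MvPolynomial (Fin n) k :=
  eMon k E a - C c * eMon k E b

lemma eBin_norm (E : Set (Fin n)) (a b : ↥E → ℕ) (c : k) (m : ↥E → ℤ)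
    (hm : ∀ i, m i = a i - b i) :
    ∃ d : ↥E → ℕ, eBin E a b c =
      eMon k E d * eBin E (fun i => (m i).toNat) (fun i => (-(m i)).toNat) c := by
  refine ⟨fun i => min (a i) (b i), ?_⟩
  have ha : a = (fun i => min (a i) (b i)) + (fun i => (m i).toNat) := by
    funext i; have := hm i; simp only [Pi.add_apply]; omega
  have hb : b = (fun i => min (a i) (b i)) + (fun i => (-(m i)).toNat) := by
    funext i; have := hm i; simp only [Pi.add_apply]; omega
  have ha' := congrArg (eMon k E) ha
  have hb' := congrArg (eMon k E) hb
  rw [eMon_add] at ha' hb'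
  unfold eBin
  rw [ha', hb']
  ring

end Helpers

theorem radical_cellular_eq_MIdeal_add_latticeIdeal
    {k : Type*} [Field k] [CharZero k] {n : ℕ}
    (I : Ideal (MvPolynomial (Fin n) k))
    (hbin : IsBinomialIdeal I) (hcell : IsCellular I) (hrad : I.IsRadical)
    (E : Set (Fin n)) (hE : E = {i : Fin n | ∀ f, X i * f ∈ I → f ∈ I}) :
    ∃ (L : AddSubgroup (↥E → ℤ)) (σ : L → kˣ),
      (∀ a b : L, σ (a + b) = σ a * σ b) ∧
      I = MIdeal E +
          Ideal.map (rename (Subtype.val : ↥E → Fin n)).toRingHom (latticeIdeal L σ) := by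
  have hE1 : ∀ i ∈ E, ∀ f, X i * f ∈ I → f ∈ I := fun i hi => by
    rw [hE] at hi; exact hi
  have hE2 : ∀ i ∉ E, (X i : MvPolynomial (Fin n) k) ∈ I := fun i hi => by
    rcases hcell.2 i with h | ⟨m, h⟩
    · exact absurd (by rw [hE]; exact h) hi
    · exact hrad ⟨m, h⟩
  clear hE
  have hM : MIdeal E ≤ I := by
    refine Ideal.span_le.2 ?_
    rintro f ⟨i, hi, rfl⟩
    exact hE2 i hi
  have hnot : ∀ a : ↥E → ℕ, ∀ u : k, C u * eMon k E a ∈ I → u = 0 := fun a u h => by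
    by_contra hu
    rw [mul_comm] at h
    have h1 := eMon_cancel hE1 a _ h
    refine hcell.1 (Ideal.eq_top_of_isUnit_mem _ h1 ?_)
    exact (isUnit_iff_ne_zero.2 hu).map C
  -- the relation defining the partial character
  let R : (↥E → ℤ) → kˣ → Prop := fun m c =>
    eBin E (fun i => (m i).toNat) (fun i => (-(m i)).toNat) (c : k) ∈ I
  have hR : ∀ (m : ↥E → ℤ) (c : kˣ) (a b : ↥E → ℕ), (∀ i, m i = a i - b i) →
      eBin E a b (c : k) ∈ I → R m c := by
    intro m c a b hm h
    obtain ⟨d, hd⟩ := eBin_norm E a b (c : k) m hm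
    rw [hd] at h
    exact eMon_cancel hE1 d _ h
  have hR0 : R 0 1 := by
    simp [R, eBin]
  have hRadd : ∀ m m' c c', R m c → R m' c' → R (m + m') (c * c') := by
    intro m m' c c' h h'
    refine hR _ _ ((fun i => (m i).toNat) + (fun i => (m' i).toNat))
      ((fun i => (-(m i)).toNat) + (fun i => (-(m' i)).toNat))
      (fun i => by simp only [Pi.add_apply]; omega) ?_
    have := I.add_mem (I.mul_mem_left (eMon k E (fun i => (m' i).toNat)) h)
      (I.mul_mem_left (C (c : k) * eMon k E (fun i => (-(m i)).toNat)) h')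
    convert this using 1
    simp only [eBin, eMon_add, Units.val_mul, C_mul]
    ring
  have hRneg : ∀ m c, R m c → R (-m) c⁻¹ := by
    intro m c h
    refine hR _ _ (fun i => (-(m i)).toNat) (fun i => (m i).toNat)
      (fun i => by simp only [Pi.neg_apply]; omega) ?_
    have := I.mul_mem_left (-C ((c⁻¹ : kˣ) : k)) h
    convert this using 1
    have h1 : (C ((c⁻¹ : kˣ) : k) : MvPolynomial (Fin n) k) * C (c : k) = 1 := by
      rw [← C_mul]; simp
    simp only [eBin]
    linear_combination (-eMon k E (fun i => (-(m i)).toNat)) * h1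
  have hRuniq : ∀ m c c', R m c → R m c' → c = c' := by
    intro m c c' h h'
    have := I.sub_mem h h'
    have h2 := hnot (fun i => (-(m i)).toNat) ((c' : k) - c) (by
      convert this using 1
      simp only [eBin, C_sub]
      ring)
    exact Units.ext (sub_eq_zero.1 h2).symm
  let L : AddSubgroup (↥E → ℤ) :=
    { carrier := {m | ∃ c, R m c}
      zero_mem' := ⟨1, hR0⟩
      add_mem' := fun {x y} ⟨c, h⟩ ⟨c', h'⟩ => ⟨c * c', hRadd _ _ _ _ h h'⟩
      neg_mem' := fun {x} ⟨c, h⟩ => ⟨c⁻¹, hRneg _ _ h⟩ }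
  have hL : ∀ m : L, ∃ c, R m c := fun m => m.2
  choose σ hσ using hL
  refine ⟨L, σ, fun a b => hRuniq _ _ _ (hσ (a + b)) (hRadd _ _ _ _ (hσ a) (hσ b)), ?_⟩
  have himg : ∀ m : L, (rename (Subtype.val : ↥E → Fin n)).toRingHom
      (monomF (fun i => ((m : ↥E → ℤ) i).toNat) -
      (σ m : k) • monomF (fun i => (-((m : ↥E → ℤ) i)).toNat)) =
      eBin E (fun i => ((m : ↥E → ℤ) i).toNat) (fun i => (-((m : ↥E → ℤ) i)).toNat) (σ m : k) := by
    intro m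
    change rename _ _ = _
    rw [map_sub, map_smul, smul_eq_C_mul]
    rfl
  apply le_antisymm
  · obtain ⟨S, hS, hIS⟩ := hbin
    have hSI : ∀ f ∈ S, f ∈ I := fun f hf => hIS ▸ Ideal.subset_span hf
    conv_lhs => rw [hIS]
    refine Ideal.span_le.2 fun f hf => ?_
    have hfI := hSI f hf
    obtain ⟨p, q, u, v, rfl⟩ := binomial_form (hS f hf)
    rw [Submodule.add_eq_sup]
    have key : ∀ (p : Fin n →₀ ℕ) (u : k), (∀ i ∉ E, p i = 0) ∨
        monomial p u ∈ (MIdeal E : Ideal (MvPolynomial (Fin n) k)) := by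
      intro p u
      by_cases h : ∀ i ∉ E, p i = 0
      · exact Or.inl h
      · push Not at h
        obtain ⟨i, hi, hp⟩ := h
        exact Or.inr (monomial_mem_MIdeal E p i hi hp u)
    rcases key p u with hp | hp <;> rcases key q v with hq | hq
    · rw [monomial_eq_eMon E p hp, monomial_eq_eMon E q hq] at hfI ⊢
      by_cases hu : u = 0
      · subst hu
        have hv := hnot _ v (by simpa using hfI)
        subst hv
        simp
      by_cases hv : v = 0
      · subst hv
        exact absurd (hnot _ u (by simpa using hfI)) hu
      let c : kˣ := Units.mk0 (-(u⁻¹ * v)) (by simp [hu, hv])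
      have hc : (C (c : k) : MvPolynomial (Fin n) k) = -(C u⁻¹ * C v) := by
        simp [c]
      have huu : (C u⁻¹ : MvPolynomial (Fin n) k) * C u = 1 := by
        rw [← C_mul, inv_mul_cancel₀ hu, C_1]
      have hb : eBin E (fun i => p i) (fun i => q i) (c : k) ∈ I := by
        have := I.mul_mem_left (C u⁻¹) hfI
        convert this using 1
        rw [eBin, hc]
        linear_combination (-eMon k E (fun i => p i)) * huu
      have hRm := hR (fun i => (p i : ℤ) - q i) c _ _ (fun i => rfl) hb
      let m : L := ⟨fun i => (p i : ℤ) - q i, ⟨c, hRm⟩⟩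
      have hcm : σ m = c := hRuniq _ _ _ (hσ m) hRm
      obtain ⟨d, hd⟩ := eBin_norm E (fun i => p i) (fun i => q i) (c : k)
        (fun i => (p i : ℤ) - q i) (fun i => rfl)
      have e : C u * eMon k E (fun i => p i) + C v * eMon k E (fun i => q i) =
          C u * eBin E (fun i => p i) (fun i => q i) (c : k) := by
        rw [eBin, hc]
        linear_combination (-C v * eMon k E (fun i => q i)) * huu
      rw [e, hd]
      refine Ideal.mul_mem_left _ _ (Ideal.mul_mem_left _ _ (Ideal.mem_sup_right ?_))
      have := Ideal.mem_map_of_mem (rename (Subtype.val : ↥E → Fin n)).toRingHom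
        (show _ ∈ latticeIdeal L σ from Ideal.subset_span ⟨m, rfl⟩)
      rw [himg, hcm] at this
      exact this
    · have h1 := (I.add_mem_iff_left (hM hq)).1 hfI
      rw [monomial_eq_eMon E p hp] at h1
      rw [hnot _ _ h1]
      simpa using Ideal.mem_sup_left hq
    · have h1 := (I.add_mem_iff_right (hM hp)).1 hfI
      rw [monomial_eq_eMon E q hq] at h1
      rw [hnot _ _ h1]
      simpa using Ideal.mem_sup_left hp
    · exact Ideal.mem_sup_left (Ideal.add_mem _ hp hq)
  · rw [Submodule.add_eq_sup]
    refine sup_le hM ?_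
    rw [latticeIdeal, Ideal.map_span, Ideal.span_le]
    rintro _ ⟨_, ⟨m, rfl⟩, rfl⟩
    rw [himg]
    exact hσ m
end

section
/- Let k be an algebraically closed field of characteristic zero and let I = M(E) + I₊(σ) be a radical cellular binomial ideal in k[x₁,…,xₙ], where (L,σ) is a partial character on ℤ^E. Then the associated primes of I are exactly the ideals P_τ = M(E) + I₊(τ), where (Sat(L),τ) runs through all saturations of (L,σ). -/
open MvPolynomial

/-- The saturation `Sat(L) = {m : ∃ d ≠ 0, d • m ∈ L}` of a lattice `L ⊆ ℤ^α`. -/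
def satSub {α : Type*} (L : AddSubgroup (α → ℤ)) : AddSubgroup (α → ℤ) where
  carrier := {m | ∃ d : ℤ, d ≠ 0 ∧ d • m ∈ L}
  zero_mem' := ⟨1, one_ne_zero, by simpa using L.zero_mem⟩
  add_mem' := by
    rintro a b ⟨d, hd, hdL⟩ ⟨e, he, heL⟩
    refine ⟨d * e, mul_ne_zero hd he, ?_⟩
    have : (d * e) • (a + b) = e • (d • a) + d • (e • b) := by
      rw [smul_add, smul_smul, smul_smul, mul_comm e d]
    rw [this]
    exact L.add_mem (AddSubgroup.zsmul_mem L hdL e) (AddSubgroup.zsmul_mem L heL d)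
  neg_mem' := by
    rintro a ⟨d, hd, hdL⟩
    exact ⟨d, hd, by simpa using L.neg_mem hdL⟩

section Helpers

variable {k : Type*} [Field k] {α : Type*} [Finite α]

/-- Partial characters extend to the whole lattice. -/
lemma exists_extension [IsAlgClosed k] (L : AddSubgroup (α → ℤ)) (σ : L → kˣ)
    (hσ : ∀ a b : L, σ (a + b) = σ a * σ b) :
    ∃ θ : Multiplicative (α → ℤ) →* kˣ, ∀ m : L, θ (Multiplicative.ofAdd (m : α → ℤ)) = σ m := by
  classical
  have hsurj : ∀ {n : ℤ}, n ≠ 0 → Function.Surjective (fun a : Additive kˣ => n • a) := by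
    have hnat : ∀ n : ℕ, n ≠ 0 → ∀ b : kˣ, ∃ a : kˣ, a ^ n = b := by
      intro n hn b
      obtain ⟨z, hz⟩ := IsAlgClosed.exists_pow_nat_eq (b : k) (Nat.pos_of_ne_zero hn)
      have hz0 : z ≠ 0 := by
        rintro rfl
        rw [zero_pow hn] at hz
        exact b.ne_zero hz.symm
      exact ⟨Units.mk0 z hz0, Units.ext (by simpa using hz)⟩
    intro n hn b
    obtain ⟨a, ha⟩ := hnat n.natAbs (Int.natAbs_ne_zero.mpr hn) b.toMul
    rcases Int.natAbs_eq n with h | h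
    · refine ⟨Additive.ofMul a, ?_⟩
      change n • Additive.ofMul a = b
      rw [h, natCast_zsmul, ← ofMul_pow, ha]; rfl
    · refine ⟨-Additive.ofMul a, ?_⟩
      change n • (-Additive.ofMul a) = b
      rw [h, neg_smul, smul_neg, neg_neg, natCast_zsmul, ← ofMul_pow, ha]; rfl
  let _ : DivisibleBy (Additive kˣ) ℤ := divisibleByOfSMulRightSurj _ _ hsurj
  let g : L →+ Additive kˣ := AddMonoidHom.mk' (fun m => Additive.ofMul (σ m)) (by
    intro a b; simp [hσ])
  obtain ⟨h, hh⟩ := (Module.Baer.of_divisible (Additive kˣ)).extension_property_addMonoidHom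
    L.subtype Subtype.val_injective g
  refine ⟨AddMonoidHom.toMultiplicativeLeft h, fun m => ?_⟩
  have := DFunLike.congr_fun hh m
  exact congrArg Additive.toMul this

lemma monomF_add (a b : α → ℕ) :
    (monomF (a + b) : MvPolynomial α k) = monomF a * monomF b := by
  unfold monomF
  rw [monomial_mul, one_mul]
  have : Finsupp.equivFunOnFinite.symm (a + b) =
      Finsupp.equivFunOnFinite.symm a + Finsupp.equivFunOnFinite.symm b := by
    ext i; simp
  rw [this]

/-- Evaluation at the point given by a character. -/
noncomputable def evChar {K : Type*} [CommRing K] [Algebra k K]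
    (χ : Multiplicative (α → ℤ) →* K) : MvPolynomial α k →ₐ[k] K := by
  classical
  exact aeval (fun i => χ (Multiplicative.ofAdd (Pi.single i 1)))

lemma evChar_monomF {K : Type*} [CommRing K] [Algebra k K]
    (χ : Multiplicative (α → ℤ) →* K) (u : α → ℕ) :
    evChar (k := k) χ (monomF u) = χ (Multiplicative.ofAdd (fun i => (u i : ℤ))) := by
  classical
  have := Fintype.ofFinite α
  unfold evChar monomF
  rw [aeval_monomial, map_one, one_mul, Finsupp.prod_fintype _ _ (by simp)]
  simp only [Finsupp.equivFunOnFinite_symm_apply_apply, ← map_pow, ← ofAdd_nsmul]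
  rw [← map_prod, ← ofAdd_sum]
  congr 2
  ext j
  simp [Finset.sum_apply, Pi.single_apply]

lemma evChar_binom {K : Type*} [CommRing K] [Algebra k K]
    (χ : Multiplicative (α → ℤ) →* K) (m : α → ℤ) (c : k) :
    evChar (k := k) χ (monomF (fun i => (m i).toNat) - c • monomF (fun i => (-(m i)).toNat)) = 0
      ↔ χ (Multiplicative.ofAdd m) = algebraMap k K c := by
  rw [map_sub, map_smul, evChar_monomF, evChar_monomF, Algebra.smul_def]
  have h1 : Multiplicative.ofAdd (fun i => ((m i).toNat : ℤ)) =
      Multiplicative.ofAdd m * Multiplicative.ofAdd (fun i => ((-(m i)).toNat : ℤ)) := by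
    rw [← ofAdd_add]
    congr 1
    ext i
    simp only [Pi.add_apply]
    omega
  rw [h1, map_mul, ← sub_mul]
  have hu : IsUnit (χ (Multiplicative.ofAdd (fun i => ((-(m i)).toNat : ℤ)))) :=
    (Group.isUnit _).map χ
  rw [hu.mul_left_eq_zero, sub_eq_zero]

lemma latticeIdeal_le_ker {K : Type*} [CommRing K] [Algebra k K]
    (χ : Multiplicative (α → ℤ) →* K) (L : AddSubgroup (α → ℤ)) (σ : L → kˣ) :
    latticeIdeal L σ ≤ RingHom.ker (evChar (k := k) χ) ↔
      ∀ m : L, χ (Multiplicative.ofAdd (m : α → ℤ)) = algebraMap k K (σ m) := by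
  unfold latticeIdeal
  rw [Ideal.span_le]
  constructor
  · intro h m
    exact (evChar_binom χ m _).1 (h ⟨m, rfl⟩)
  · rintro h _ ⟨m, rfl⟩
    exact (evChar_binom χ m _).2 (h m)

/-- General binomials in the lattice ideal. -/
lemma binom_mem_s8 (L : AddSubgroup (α → ℤ)) (σ : L → kˣ) (u v : α → ℕ)
    (h : (fun i => (u i : ℤ) - v i) ∈ L) :
    (monomF u - (σ ⟨_, h⟩ : k) • monomF v : MvPolynomial α k) ∈ latticeIdeal L σ := by
  have hu : u = (fun i => min (u i) (v i)) + (fun i => ((u i : ℤ) - v i).toNat) := by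
    ext i; simp only [Pi.add_apply]; omega
  have hv : v = (fun i => min (u i) (v i)) + (fun i => (-((u i : ℤ) - v i)).toNat) := by
    ext i; simp only [Pi.add_apply]; omega
  have key : (monomF u - (σ ⟨_, h⟩ : k) • monomF v : MvPolynomial α k) =
      monomF (fun i => min (u i) (v i)) * (monomF (fun i => ((u i : ℤ) - v i).toNat) -
        (σ ⟨_, h⟩ : k) • monomF (fun i => (-((u i : ℤ) - v i)).toNat)) := by
    rw [mul_sub, mul_smul_comm, ← monomF_add, ← monomF_add, ← hu, ← hv]
  rw [key]
  exact Ideal.mul_mem_left _ _ (Ideal.subset_span ⟨⟨_, h⟩, rfl⟩)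

lemma latticeIdeal_prime [IsAlgClosed k] (L : AddSubgroup (α → ℤ))
    (hL : ∀ (m : α → ℤ) (d : ℤ), d ≠ 0 → d • m ∈ L → m ∈ L) (τ : L → kˣ)
    (hτ : ∀ a b : L, τ (a + b) = τ a * τ b) :
    (latticeIdeal L τ).IsPrime ∧ ∀ u : α → ℕ, monomF u ∉ latticeIdeal L τ := by
  classical
  obtain ⟨θ, hθ⟩ := exists_extension L τ hτ
  have hG : IsAddTorsionFree ((α → ℤ) ⧸ L) := by
    constructor
    intro n hn a b
    induction a using QuotientAddGroup.induction_on with | _ a => ?_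
    induction b using QuotientAddGroup.induction_on with | _ b => ?_
    intro hab
    have hab' : ((n • a : α → ℤ) : (α → ℤ) ⧸ L) = ((n • b : α → ℤ) : (α → ℤ) ⧸ L) := hab
    rw [QuotientAddGroup.eq] at hab' ⊢
    refine hL _ (n : ℤ) (by exact_mod_cast hn) ?_
    rw [natCast_zsmul, smul_add, smul_neg]
    exact hab'
  have hfg : AddMonoid.FG ((α → ℤ) ⧸ L) := by
    have h1 : AddGroup.FG (α → ℤ) := Module.Finite.iff_addGroup_fg.1 inferInstance
    exact AddGroup.fg_iff_addMonoid_fg.1 (QuotientAddGroup.fg L)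
  have hU : TwoUniqueSums ((α → ℤ) ⧸ L) := inferInstance
  have hdom : IsDomain (AddMonoidAlgebra k ((α → ℤ) ⧸ L)) := inferInstance
  let χ : Multiplicative (α → ℤ) →* AddMonoidAlgebra k ((α → ℤ) ⧸ L) :=
    { toFun := fun m => AddMonoidAlgebra.single
        ((Multiplicative.toAdd m : α → ℤ) : (α → ℤ) ⧸ L) (θ m : k)
      map_one' := by simp [AddMonoidAlgebra.one_def]
      map_mul' := by intro a b; simp [AddMonoidAlgebra.single_mul_single] }
  have hχ : ∀ m : α → ℤ, χ (Multiplicative.ofAdd m) =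
      AddMonoidAlgebra.single (m : (α → ℤ) ⧸ L) (θ (Multiplicative.ofAdd m) : k) := fun m => rfl
  have hle : latticeIdeal L τ ≤ RingHom.ker (evChar (k := k) χ) := by
    rw [latticeIdeal_le_ker]
    intro m
    rw [hχ, hθ, (QuotientAddGroup.eq_zero_iff (m : α → ℤ)).2 m.2]
    rfl
  have hno : ∀ u : α → ℕ, evChar (k := k) χ (monomF u) ≠ 0 := by
    intro u
    rw [evChar_monomF]
    exact ((Group.isUnit _).map χ).ne_zero
  have hge : RingHom.ker (evChar (k := k) χ) ≤ latticeIdeal L τ := by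
    -- a section
    let nat2 : (α → ℕ) → (α → ℤ) := fun u i => (u i : ℤ)
    let r : ((α → ℤ) ⧸ L) → (α → ℕ) := fun g =>
      if h : ∃ u : α → ℕ, ((nat2 u : α → ℤ) : (α → ℤ) ⧸ L) = g then h.choose else 0
    have hr : ∀ u : α → ℕ, ((nat2 (r (nat2 u : α → ℤ)) : α → ℤ) : (α → ℤ) ⧸ L) =
        ((nat2 u : α → ℤ) : (α → ℤ) ⧸ L) := by
      intro u
      have h : ∃ v : α → ℕ, ((nat2 v : α → ℤ) : (α → ℤ) ⧸ L) = (nat2 u : α → ℤ) := ⟨u, rfl⟩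
      simp only [r, dif_pos h]
      exact h.choose_spec
    let J := latticeIdeal L τ
    let s : AddMonoidAlgebra k ((α → ℤ) ⧸ L) →ₗ[k] (MvPolynomial α k ⧸ J) :=
      (Finsupp.linearCombination k (fun g => Ideal.Quotient.mk J
        (((θ (Multiplicative.ofAdd (nat2 (r g))))⁻¹ : kˣ) • monomF (r g)))) ∘ₗ
        (AddMonoidAlgebra.coeffLinearEquiv k).toLinearMap
    have hs : s ∘ₗ (evChar (k := k) χ).toLinearMap = (Ideal.Quotient.mkₐ k J).toLinearMap := by
      apply MvPolynomial.linearMap_ext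
      intro u
      ext
      have hu : (monomial u (1 : k)) = monomF (u : α → ℕ) := by
        unfold monomF
        congr 1
        ext i; simp
      simp only [LinearMap.comp_apply, AlgHom.toLinearMap_apply, hu, evChar_monomF, hχ]
      have hsing : ∀ (g : (α → ℤ) ⧸ L) (c : k), s (AddMonoidAlgebra.single g c) =
          c • Ideal.Quotient.mk J
            (((θ (Multiplicative.ofAdd (nat2 (r g))))⁻¹ : kˣ) • monomF (r g)) := by
        intro g c
        exact Finsupp.linearCombination_single k c g
      rw [hsing]
      set v := r (nat2 u : α → ℤ) with hv
      have hmem : (fun i => ((u : α → ℕ) i : ℤ) - v i) ∈ L := by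
        have := hr u
        rw [QuotientAddGroup.eq] at this
        convert this using 1
        ext i
        simp [nat2, hv]
        ring
      have hb := binom_mem_s8 L τ u v hmem
      have hc : (τ ⟨_, hmem⟩) = θ (Multiplicative.ofAdd (nat2 u)) *
          (θ (Multiplicative.ofAdd (nat2 v)))⁻¹ := by
        rw [← hθ, ← map_inv, ← map_mul]
        congr 1
      have h2 : Ideal.Quotient.mk J (monomF u) =
          Ideal.Quotient.mk J ((τ ⟨_, hmem⟩ : k) • monomF v) :=
        (Ideal.Quotient.mk_eq_mk_iff_sub_mem _ _).2 hb
      change _ = Ideal.Quotient.mk J (monomF u)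
      rw [h2, hc]
      change _ • (Ideal.Quotient.mkₐ k J) _ = (Ideal.Quotient.mkₐ k J) _
      rw [← map_smul, Units.smul_def, smul_smul, Units.val_mul]
    intro f hf
    have := LinearMap.congr_fun hs f
    rw [LinearMap.comp_apply, AlgHom.toLinearMap_apply, (RingHom.mem_ker).1 hf, map_zero] at this
    exact Ideal.Quotient.eq_zero_iff_mem.1 this.symm
  have heq := le_antisymm hle hge
  rw [heq]
  exact ⟨RingHom.ker_isPrime _, fun u h => hno u h⟩

lemma X_eq_monomF [DecidableEq α] (i : α) : (X i : MvPolynomial α k) = monomF (Pi.single i 1) := by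
  unfold monomF X
  congr 1
  ext j
  simp [Finsupp.single_apply, Pi.single_apply, eq_comm]

/-- A root of a constant in an extension domain is a constant. -/
lemma root_mem_range [IsAlgClosed k] {K : Type*} [Field K] [Algebra k K] (t : K) (d : ℕ)
    (hd : d ≠ 0) (s : k) (h : t ^ d = algebraMap k K s) : ∃ c : k, algebraMap k K c = t := by
  have hint : IsIntegral k t := by
    refine IsIntegral.of_pow (Nat.pos_of_ne_zero hd) ?_
    rw [h]; exact isIntegral_algebraMap
  exact minpoly.mem_range_of_degree_eq_one k t
    (IsAlgClosed.degree_eq_one_of_irreducible k (minpoly.irreducible hint))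

lemma exists_sat_le [IsAlgClosed k] (L : AddSubgroup (α → ℤ)) (σ : L → kˣ)
    (Q : Ideal (MvPolynomial α k)) (hQ : Q.IsPrime) (hle : latticeIdeal L σ ≤ Q)
    (hX : ∀ i, X i ∉ Q) :
    ∃ τ : ↥(satSub L) → kˣ, (∀ a b : ↥(satSub L), τ (a + b) = τ a * τ b) ∧
        (∀ (m : α → ℤ) (h : m ∈ L),
          τ ⟨m, ⟨1, one_ne_zero, by simpa using h⟩⟩ = σ ⟨m, h⟩) ∧
        latticeIdeal (satSub L) τ ≤ Q := by
  classical
  have := Fintype.ofFinite α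
  let K := FractionRing (MvPolynomial α k ⧸ Q)
  let π : MvPolynomial α k →ₐ[k] K :=
    (IsScalarTower.toAlgHom k (MvPolynomial α k ⧸ Q) K).comp (Ideal.Quotient.mkₐ k Q)
  have hπ : ∀ f, π f = 0 ↔ f ∈ Q := by
    intro f
    rw [← Ideal.Quotient.eq_zero_iff_mem]
    exact map_eq_zero_iff (algebraMap (MvPolynomial α k ⧸ Q) K) (IsFractionRing.injective _ _)
  have hy : ∀ i, π (X i) ≠ 0 := fun i h => hX i ((hπ _).1 h)
  let χ : Multiplicative (α → ℤ) →* K :=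
    { toFun := fun m => ∏ i, π (X i) ^ (Multiplicative.toAdd m i)
      map_one' := by simp
      map_mul' := by
        intro a b
        rw [← Finset.prod_mul_distrib]
        refine Finset.prod_congr rfl fun i _ => ?_
        rw [← zpow_add₀ (hy i)]
        rfl }
  have hev : evChar (k := k) χ = π := by
    apply MvPolynomial.algHom_ext
    intro i
    have : evChar (k := k) χ (X i) = χ (Multiplicative.ofAdd (Pi.single i 1)) := by
      unfold evChar
      rw [aeval_X]
    rw [this]
    change ∏ j, π (X j) ^ ((Pi.single i 1 : α → ℤ) j) = π (X i)
    rw [Finset.prod_eq_single i]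
    · simp
    · intro j _ hj; simp [hj]
    · simp
  have hker : RingHom.ker (evChar (k := k) χ) = Q := by
    ext f
    rw [RingHom.mem_ker, hev, hπ]
  have hσ' := (latticeIdeal_le_ker χ L σ).1 (hker.symm ▸ hle)
  have hχ0 : ∀ m, χ m ≠ 0 := fun m => ((Group.isUnit m).map χ).ne_zero
  have hex : ∀ m : satSub L, ∃ c : kˣ, algebraMap k K c = χ (Multiplicative.ofAdd (m : α → ℤ)) := by
    rintro ⟨m, d, hd, hdm⟩
    have h1 : ∃ s : k, χ (Multiplicative.ofAdd m) ^ d.natAbs = algebraMap k K s := by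
      rw [← map_pow, ← ofAdd_nsmul]
      have hmem : d.natAbs • m ∈ L := by
        rcases Int.natAbs_eq d with h | h
        · rw [h, natCast_zsmul] at hdm
          exact hdm
        · rw [h, neg_smul, natCast_zsmul] at hdm
          exact neg_mem_iff.1 hdm
      exact ⟨_, hσ' ⟨_, hmem⟩⟩
    obtain ⟨s, hs⟩ := h1
    obtain ⟨c, hc⟩ := root_mem_range _ _ (Int.natAbs_ne_zero.2 hd) s hs
    have hc0 : c ≠ 0 := by
      rintro rfl
      rw [map_zero] at hc
      exact hχ0 _ hc.symm
    exact ⟨Units.mk0 c hc0, hc⟩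
  choose τ hτ using hex
  have hinj : ∀ a b : kˣ, algebraMap k K a = algebraMap k K b → a = b := fun a b h =>
    Units.ext ((algebraMap k K).injective h)
  refine ⟨τ, ?_, ?_, ?_⟩
  · intro a b
    apply hinj
    rw [Units.val_mul, map_mul, hτ, hτ, hτ, ← map_mul, ← ofAdd_add]
    rfl
  · intro m h
    apply hinj
    rw [hτ, ← hσ']
  · rw [← hker, latticeIdeal_le_ker]
    intro m
    exact (hτ m).symm

/-- Comparable saturations are equal. -/
lemma eq_of_le [IsAlgClosed k] (L : AddSubgroup (α → ℤ)) (τ τ' : L → kˣ)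
    (hno : ∀ u : α → ℕ, monomF u ∉ latticeIdeal L τ)
    (hle : latticeIdeal L τ' ≤ latticeIdeal L τ) : τ' = τ := by
  funext m
  have h1 := hle (Ideal.subset_span ⟨m, rfl⟩)
  have h2 : _ ∈ latticeIdeal L τ := Ideal.subset_span ⟨m, rfl⟩
  have h3 := Ideal.sub_mem _ h2 h1
  rw [sub_sub_sub_cancel_left, ← sub_smul] at h3
  by_contra hne
  have hc : (τ' m : k) - τ m ≠ 0 := fun h => hne (Units.ext (sub_eq_zero.1 h))
  refine hno (fun i => (-((m : α → ℤ) i)).toNat) ?_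
  have h4 := Ideal.mul_mem_left (latticeIdeal L τ) (C ((τ' m : k) - τ m)⁻¹) h3
  rwa [smul_eq_C_mul, ← mul_assoc, ← C_mul, inv_mul_cancel₀ hc, C_1, one_mul] at h4

lemma satSub_sat (L : AddSubgroup (α → ℤ)) (m : α → ℤ) (d : ℤ) (hd : d ≠ 0)
    (h : d • m ∈ satSub L) : m ∈ satSub L := by
  obtain ⟨e, he, h⟩ := h
  exact ⟨e * d, mul_ne_zero he hd, by rwa [mul_smul]⟩

end Helpers

section Retract

variable {k : Type*} [Field k] {n : ℕ} (E : Set (Fin n))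

/-- The retraction killing the variables outside `E`. -/
noncomputable def retr : MvPolynomial (Fin n) k →ₐ[k] MvPolynomial ↥E k := by
  classical
  exact aeval (fun i => if h : i ∈ E then X ⟨i, h⟩ else 0)

lemma retr_X_mem (i : ↥E) : retr (k := k) E (X (i : Fin n)) = X i := by
  unfold retr
  rw [aeval_X, dif_pos i.2]

lemma retr_X_not_mem (i : Fin n) (h : i ∉ E) : retr (k := k) E (X i) = 0 := by
  unfold retr
  rw [aeval_X, dif_neg h]

lemma retr_rename (f : MvPolynomial ↥E k) :
    retr E (rename (Subtype.val : ↥E → Fin n) f) = f := by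
  have : (retr E).comp (rename (Subtype.val : ↥E → Fin n)) = AlgHom.id k _ := by
    apply MvPolynomial.algHom_ext
    intro i
    rw [AlgHom.comp_apply, rename_X, retr_X_mem]
    rfl
  exact DFunLike.congr_fun this f

lemma sub_mem_MIdeal (f : MvPolynomial (Fin n) k) :
    f - rename (Subtype.val : ↥E → Fin n) (retr E f) ∈ MIdeal (k := k) E := by
  have : (Ideal.Quotient.mkₐ k (MIdeal (k := k) E)) =
      (Ideal.Quotient.mkₐ k (MIdeal (k := k) E)).comp
        ((rename (Subtype.val : ↥E → Fin n)).comp (retr E)) := by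
    apply MvPolynomial.algHom_ext
    intro i
    rw [AlgHom.comp_apply, AlgHom.comp_apply]
    by_cases h : i ∈ E
    · have := retr_X_mem (k := k) E ⟨i, h⟩
      rw [this, rename_X]
    · rw [retr_X_not_mem E i h, map_zero, map_zero]
      exact Ideal.Quotient.eq_zero_iff_mem.2 (Ideal.subset_span ⟨i, h, rfl⟩)
  exact (Ideal.Quotient.mk_eq_mk_iff_sub_mem _ _).1 (DFunLike.congr_fun this f)

lemma add_eq_comap (J : Ideal (MvPolynomial ↥E k)) :
    MIdeal E + Ideal.map (rename (Subtype.val : ↥E → Fin n)).toRingHom J =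
      J.comap (retr E) := by
  apply le_antisymm
  · refine sup_le ?_ ?_
    · unfold MIdeal
      rw [Ideal.span_le]
      rintro _ ⟨i, hi, rfl⟩
      change retr E (X i) ∈ J
      rw [retr_X_not_mem E i hi]
      exact J.zero_mem
    · rw [Ideal.map_le_iff_le_comap]
      intro f hf
      change retr E (rename (Subtype.val : ↥E → Fin n) f) ∈ J
      rwa [retr_rename]
  · intro f hf
    have h1 := sub_mem_MIdeal E f
    have h2 : rename (Subtype.val : ↥E → Fin n) (retr E f) ∈
        Ideal.map (rename (Subtype.val : ↥E → Fin n)).toRingHom J :=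
      Ideal.mem_map_of_mem (rename (Subtype.val : ↥E → Fin n)).toRingHom hf
    rw [← sub_add_cancel f (rename (Subtype.val : ↥E → Fin n) (retr E f))]
    exact Submodule.add_mem_sup h1 h2

end Retract

/-- Associated primes of a radical ideal are its minimal primes. -/
lemma assoc_radical {R : Type*} [CommRing R] [IsNoetherianRing R] (I : Ideal R)
    (hrad : I.IsRadical) (Q : Ideal R) :
    Q ∈ associatedPrimes R (R ⧸ I) ↔ Q ∈ I.minimalPrimes := by
  constructor
  · intro hQ
    obtain ⟨hQp, x, hx⟩ := isAssociatedPrime_iff.1 hQ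
    obtain ⟨f, rfl⟩ := Ideal.Quotient.mk_surjective x
    have hmem : ∀ r, r ∈ Q ↔ r * f ∈ I := by
      intro r
      rw [hx, Submodule.mem_colon_singleton, Submodule.mem_bot, ← Ideal.Quotient.eq_zero_iff_mem,
        map_mul]
      rfl
    have hf : f ∉ I := by
      intro hf
      exact hQp.ne_top ((Ideal.eq_top_iff_one _).2 ((hmem 1).2 (by simpa using hf)))
    have hf' : f ∉ sInf I.minimalPrimes := by
      rw [Ideal.sInf_minimalPrimes, hrad.radical]
      exact hf
    rw [Ideal.mem_sInf] at hf'
    push Not at hf'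
    obtain ⟨p, hp, hfp⟩ := hf'
    have hle : Q ≤ p := by
      intro r hr
      exact (hp.1.1.mem_or_mem (hp.1.2 ((hmem r).1 hr))).resolve_right hfp
    have hIQ : I ≤ Q := fun r hr => (hmem r).2 (I.mul_mem_right f hr)
    have : Q = p := le_antisymm hle (hp.2 ⟨hQp, hIQ⟩ hle)
    rw [this]
    exact hp
  · intro hQ
    apply Module.associatedPrimes.minimalPrimes_annihilator_subset_associatedPrimes R (R ⧸ I)
    rwa [Ideal.annihilator_quotient]

lemma not_mem_of_assoc {R : Type*} [CommRing R] [IsNoetherianRing R] (I : Ideal R) (Q : Ideal R)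
    (hQ : Q ∈ associatedPrimes R (R ⧸ I)) (a : R) (ha : ∀ f, a * f ∈ I → f ∈ I) : a ∉ Q := by
  obtain ⟨hQp, x, hx⟩ := isAssociatedPrime_iff.1 hQ
  obtain ⟨f, rfl⟩ := Ideal.Quotient.mk_surjective x
  have hmem : ∀ r, r ∈ Q ↔ r * f ∈ I := by
    intro r
    rw [hx, Submodule.mem_colon_singleton, Submodule.mem_bot, ← Ideal.Quotient.eq_zero_iff_mem,
      map_mul]
    rfl
  intro h
  have hf := ha f ((hmem a).1 h)
  exact hQp.ne_top ((Ideal.eq_top_iff_one _).2 ((hmem 1).2 (by simpa using hf)))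

/-- The lattice ideal of an extension contains the lattice ideal. -/
lemma latticeIdeal_le_sat {k : Type*} [Field k] {α : Type*} [Finite α]
    (L : AddSubgroup (α → ℤ)) (σ : L → kˣ) (τ : ↥(satSub L) → kˣ)
    (h : ∀ (m : α → ℤ) (h : m ∈ L),
          τ ⟨m, ⟨1, one_ne_zero, by simpa using h⟩⟩ = σ ⟨m, h⟩) :
    latticeIdeal L σ ≤ latticeIdeal (satSub L) τ := by
  unfold latticeIdeal
  apply Ideal.span_mono
  rintro _ ⟨m, rfl⟩
  exact ⟨⟨m, ⟨1, one_ne_zero, by simp⟩⟩, by rw [h m m.2]⟩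

theorem associatedPrimes_of_radical_cellular
    {k : Type*} [Field k] [IsAlgClosed k] [CharZero k] {n : ℕ}
    (E : Set (Fin n)) (L : AddSubgroup (↥E → ℤ)) (σ : L → kˣ)
    (hσ : ∀ a b : L, σ (a + b) = σ a * σ b)
    (I : Ideal (MvPolynomial (Fin n) k))
    (hI : I = MIdeal E +
        Ideal.map (rename (Subtype.val : ↥E → Fin n)).toRingHom (latticeIdeal L σ))
    (hcell : IsCellular I) (hrad : I.IsRadical) :
    associatedPrimes (MvPolynomial (Fin n) k) (MvPolynomial (Fin n) k ⧸ I) =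
      {P | ∃ τ : ↥(satSub L) → kˣ,
        (∀ a b : ↥(satSub L), τ (a + b) = τ a * τ b) ∧
        (∀ (m : ↥E → ℤ) (h : m ∈ L),
          τ ⟨m, ⟨1, one_ne_zero, by simpa using h⟩⟩ = σ ⟨m, h⟩) ∧
        P = MIdeal E +
          Ideal.map (rename (Subtype.val : ↥E → Fin n)).toRingHom
            (latticeIdeal (satSub L) τ)} := by
  classical
  have hcomap := add_eq_comap (k := k) E
  have hI' : I = (latticeIdeal L σ).comap (retr E) := hI.trans (hcomap _)
  have hMI : MIdeal E ≤ I := hI ▸ le_sup_left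
  have hren : ∀ f ∈ latticeIdeal L σ, rename (Subtype.val : ↥E → Fin n) f ∈ I := by
    intro f hf
    rw [hI']
    change retr E (rename (Subtype.val : ↥E → Fin n) f) ∈ latticeIdeal L σ
    rwa [retr_rename]
  -- the step common to both inclusions
  have hstep : ∀ Q : Ideal (MvPolynomial (Fin n) k), Q.IsPrime → I ≤ Q →
      (∀ i : ↥E, X (i : Fin n) ∉ Q) →
      ∃ τ : ↥(satSub L) → kˣ,
        (∀ a b : ↥(satSub L), τ (a + b) = τ a * τ b) ∧
        (∀ (m : ↥E → ℤ) (h : m ∈ L),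
          τ ⟨m, ⟨1, one_ne_zero, by simpa using h⟩⟩ = σ ⟨m, h⟩) ∧
        (latticeIdeal (satSub L) τ).comap (retr E) ≤ Q := by
    intro Q hQ hIQ hX
    have hQ' : (Q.comap (rename (Subtype.val : ↥E → Fin n)).toRingHom).IsPrime :=
      Ideal.comap_isPrime _ _
    obtain ⟨τ, h1, h2, h3⟩ := exists_sat_le L σ
      (Q.comap (rename (Subtype.val : ↥E → Fin n)).toRingHom) hQ'
      (fun f hf => hIQ (hren f hf)) (fun i hi => hX i (by
        have : rename (Subtype.val : ↥E → Fin n) (X i : MvPolynomial ↥E k) ∈ Q := hi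
        rwa [rename_X] at this))
    refine ⟨τ, h1, h2, ?_⟩
    rw [← hcomap]
    exact sup_le (hMI.trans hIQ) (Ideal.map_le_iff_le_comap.2 h3)
  have hprime := fun (τ : ↥(satSub L) → kˣ) hτ =>
    latticeIdeal_prime (satSub L) (satSub_sat L) τ hτ
  have hcle : ∀ τ : ↥(satSub L) → kˣ, (∀ (m : ↥E → ℤ) (h : m ∈ L),
      τ ⟨m, ⟨1, one_ne_zero, by simpa using h⟩⟩ = σ ⟨m, h⟩) →
      I ≤ (latticeIdeal (satSub L) τ).comap (retr E) := by
    intro τ hτ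
    rw [hI']
    exact Ideal.comap_mono (latticeIdeal_le_sat L σ τ hτ)
  have hXnot : ∀ (τ : ↥(satSub L) → kˣ), (∀ a b : ↥(satSub L), τ (a + b) = τ a * τ b) →
      ∀ i : ↥E, X (i : Fin n) ∉ (latticeIdeal (satSub L) τ).comap (retr E) := by
    intro τ hτ i hi
    have hi' : retr E (X (i : Fin n)) ∈ latticeIdeal (satSub L) τ := hi
    rw [retr_X_mem, X_eq_monomF] at hi'
    exact (hprime τ hτ).2 _ hi'
  ext P
  rw [Set.mem_ofPred_eq]
  constructor
  · intro hP
    have hmin := (assoc_radical I hrad P).1 hP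
    have hX : ∀ i : ↥E, X (i : Fin n) ∉ P := by
      intro i
      rcases hcell.2 i with h | ⟨m, hm⟩
      · exact not_mem_of_assoc I P hP _ h
      · exfalso
        obtain ⟨θ, hθ⟩ := exists_extension L σ hσ
        let τ : ↥(satSub L) → kˣ := fun m => θ (Multiplicative.ofAdd (m : ↥E → ℤ))
        have hτ : ∀ a b : ↥(satSub L), τ (a + b) = τ a * τ b := by
          intro a b
          simp only [τ]
          rw [← map_mul, ← ofAdd_add]
          rfl
        have := (hprime τ hτ).1
        exact hXnot τ hτ i ((Ideal.comap_isPrime (retr E) (latticeIdeal (satSub L) τ)).mem_of_pow_mem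
          m (hcle τ (fun m h => hθ ⟨m, h⟩) hm))
    obtain ⟨τ, h1, h2, h3⟩ := hstep P hmin.1.1 hmin.1.2 hX
    refine ⟨τ, h1, h2, ?_⟩
    rw [hcomap]
    have := (hprime τ h1).1
    exact le_antisymm (hmin.2 ⟨Ideal.comap_isPrime _ _, hcle τ h2⟩ h3) h3
  · rintro ⟨τ, h1, h2, rfl⟩
    rw [hcomap, assoc_radical I hrad]
    have := (hprime τ h1).1
    refine ⟨⟨Ideal.comap_isPrime _ _, hcle τ h2⟩, ?_⟩
    rintro Q ⟨hQ, hIQ⟩ hQP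
    obtain ⟨τ', h1', h2', h3⟩ := hstep Q hQ hIQ (fun i hi => hXnot τ h1 i (hQP hi))
    have heq : τ' = τ := by
      refine eq_of_le _ τ τ' (hprime τ h1).2 ?_
      intro f hf
      have : rename (Subtype.val : ↥E → Fin n) f ∈ (latticeIdeal (satSub L) τ).comap (retr E) := by
        apply hQP
        apply h3
        change retr E (rename (Subtype.val : ↥E → Fin n) f) ∈ latticeIdeal (satSub L) τ'
        rwa [retr_rename]
      have h4 : retr E (rename (Subtype.val : ↥E → Fin n) f) ∈ latticeIdeal (satSub L) τ := this
      rwa [retr_rename] at h4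
    rw [← heq]
    exact h3
end

section
/- Let k be an algebraically closed field of characteristic zero and let I ⊊ k[x₁,…,xₙ] be a radical cellular binomial ideal. Then I is equidimensional: all minimal primes of I have the same height (equivalently, all irreducible components of the variety of I have the same dimension). -/
open MvPolynomial

/-- Scaling of the variables. -/
noncomputable def scaleHom {k : Type*} [Field k] {n : ℕ} (l : Fin n → k) :
    MvPolynomial (Fin n) k →ₐ[k] MvPolynomial (Fin n) k :=
  aeval (fun i => C (l i) * X i)

theorem scaleHom_monomial {k : Type*} [Field k] {n : ℕ} (l : Fin n → k) (u : Fin n →₀ ℕ) (a : k) :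
    scaleHom l (monomial u a) = C (∏ i, l i ^ u i) * monomial u a := by
  rw [scaleHom, aeval_monomial, monomial_eq, Finsupp.prod_fintype _ _ (by simp),
    Finsupp.prod_fintype _ _ (by simp)]
  simp only [mul_pow, Finset.prod_mul_distrib, map_prod, map_pow, algebraMap_eq]
  ring

theorem scaleHom_scaleHom {k : Type*} [Field k] {n : ℕ} (l m : Fin n → k)
    (h : ∀ i, l i * m i = 1) : (scaleHom l).comp (scaleHom m) = AlgHom.id k _ := by
  ext1 i
  have h2 : (C (m i) * C (l i) : MvPolynomial (Fin n) k) = 1 := by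
    rw [← C_mul, mul_comm, h, C_1]
  simp only [scaleHom, AlgHom.comp_apply, aeval_X, map_mul, AlgHom.id_apply, algHom_C,
    algebraMap_eq]
  rw [← mul_assoc, h2, one_mul]

theorem eval_scaleHom {k : Type*} [Field k] {n : ℕ} (l p q : Fin n → k)
    (h : ∀ i, l i * p i = q i) (f : MvPolynomial (Fin n) k) :
    aeval p (scaleHom l f) = aeval q f := by
  have : (aeval p : _ →ₐ[k] k).comp (scaleHom l) = aeval q := by
    ext i
    simp [scaleHom, h]
  exact congrArg (fun g => g f) this

/-- Scaling by the quotient of two points of the torus part preserves the ideal. -/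
theorem scaleHom_mem {k : Type*} [Field k] {n : ℕ}
    (I : Ideal (MvPolynomial (Fin n) k)) (hbin : IsBinomialIdeal I)
    (p q l : Fin n → k) (hp : ∀ f ∈ I, aeval p f = 0) (hq : ∀ f ∈ I, aeval q f = 0)
    (hp0 : ∀ i, X i ∉ I → p i ≠ 0) (hlpq : ∀ i, l i * p i = q i)
    (f : MvPolynomial (Fin n) k) (hf : f ∈ I) : scaleHom l f ∈ I := by
  obtain ⟨S, hS, rfl⟩ := hbin
  suffices h : Ideal.span S ≤ (Ideal.span S).comap (scaleHom l) from h hf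
  rw [Ideal.span_le]
  intro g hg
  have hgI : g ∈ Ideal.span S := Ideal.subset_span hg
  have hcard : g.support.card ≤ 2 := hS g hg
  set I := Ideal.span S with hI
  show scaleHom l g ∈ I
  have key : ∃ c : k, ∀ u ∈ g.support, (∀ a, monomial u a ∈ I) ∨ ∏ i, l i ^ u i = c := by
    have hmono : ∀ u : Fin n →₀ ℕ, (∃ i, u i ≠ 0 ∧ X i ∈ I) → ∀ a, monomial u a ∈ I := by
      rintro u ⟨i, hi, hX⟩ a
      have : (X i : MvPolynomial (Fin n) k) ∣ monomial u a := by
        rw [X_dvd_monomial]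
        exact Or.inr hi
      exact Ideal.mem_of_dvd I this hX
    by_cases hA : ∃ u ∈ g.support, ¬ ∃ i, u i ≠ 0 ∧ X i ∈ I
    · obtain ⟨u, hu, hu'⟩ := hA
      refine ⟨∏ i, l i ^ u i, fun v hv => ?_⟩
      by_cases hv' : ∃ i, v i ≠ 0 ∧ X i ∈ I
      · exact Or.inl (hmono v hv')
      right
      by_cases huv : v = u
      · rw [huv]
      have hsupp : g.support = {v, u} := by
        symm
        apply Finset.eq_of_subset_of_card_le
        · intro w hw
          simp only [Finset.mem_insert, Finset.mem_singleton] at hw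
          rcases hw with rfl | rfl <;> assumption
        · rw [Finset.card_pair huv]; exact hcard
      have hev : ∀ x : Fin n → k, aeval x g =
          coeff v g * ∏ i, x i ^ v i + coeff u g * ∏ i, x i ^ u i := by
        intro x
        rw [aeval_eq_eval, eval_eq', hsupp, Finset.sum_pair huv]
      have nz : ∀ w : Fin n →₀ ℕ, (¬ ∃ i, w i ≠ 0 ∧ X i ∈ I) → ∏ i, p i ^ w i ≠ 0 := by
        intro w hw
        rw [Finset.prod_ne_zero_iff]
        intro i _
        by_cases hwi : w i = 0
        · simp [hwi]
        · exact pow_ne_zero _ (hp0 i fun h => hw ⟨i, hwi, h⟩)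
      have hmul : ∀ w : Fin n →₀ ℕ, ∏ i, q i ^ w i = (∏ i, l i ^ w i) * ∏ i, p i ^ w i := by
        intro w
        rw [← Finset.prod_mul_distrib]
        simp [← hlpq, mul_pow]
      have e1 := hp g hgI
      have e2 := hq g hgI
      rw [hev] at e1 e2
      rw [hmul, hmul] at e2
      have hc : coeff v g ≠ 0 := mem_support_iff.1 hv
      have : (coeff v g * ∏ i, p i ^ v i) * ((∏ i, l i ^ v i) - ∏ i, l i ^ u i) = 0 := by
        linear_combination e2 - (∏ i, l i ^ u i) * e1
      have := (mul_eq_zero.1 this).resolve_left (mul_ne_zero hc (nz v hv'))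
      exact sub_eq_zero.1 this
    · push Not at hA
      exact ⟨0, fun u hu => Or.inl (hmono u (hA u hu))⟩
  obtain ⟨c, hc⟩ := key
  have h1 : scaleHom l g - C c * g ∈ I := by
    have : scaleHom l g - C c * g =
        ∑ u ∈ g.support, C ((∏ i, l i ^ u i) - c) * monomial u (coeff u g) := by
      conv_lhs => rw [g.as_sum]
      rw [map_sum, Finset.mul_sum, ← Finset.sum_sub_distrib]
      refine Finset.sum_congr rfl fun u _ => ?_
      rw [scaleHom_monomial, C_sub, sub_mul]
    rw [this]
    refine Ideal.sum_mem _ fun u hu => ?_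
    rcases hc u hu with h | h
    · exact Ideal.mul_mem_left _ _ (h _)
    · simp [h]
  have := I.add_mem h1 (I.mul_mem_left (C c) hgI)
  simpa using this

/-- Every component of a radical cellular ideal has a point on no other component, whose
coordinates vanish only for the variables in the ideal. -/
theorem exists_generic_point {k : Type*} [Field k] [IsAlgClosed k] {n : ℕ}
    (I : Ideal (MvPolynomial (Fin n) k))
    (hcell : ∀ i : Fin n, X i ∈ I ∨ ∀ f, X i * f ∈ I → f ∈ I) (hrad : I.IsRadical)
    (Q : Ideal (MvPolynomial (Fin n) k)) (hQ : Q ∈ I.minimalPrimes) :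
    ∃ q : Fin n → k, (∀ f ∈ Q, aeval q f = 0) ∧ (∀ i, X i ∉ I → q i ≠ 0) ∧
      ∀ P ∈ I.minimalPrimes, (∀ f ∈ P, aeval q f = 0) → P = Q := by
  classical
  have hQp : Q.IsPrime := hQ.1.1
  have hfin : I.minimalPrimes.Finite := I.finite_minimalPrimes_of_isNoetherianRing
  have hex : ∀ P : Ideal (MvPolynomial (Fin n) k), ∃ g, g ∉ Q ∧
      (P ∈ I.minimalPrimes → P ≠ Q → g ∈ P) := by
    intro P
    by_cases h : P ∈ I.minimalPrimes ∧ P ≠ Q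
    · have : ¬ P ≤ Q := fun hle => h.2 (le_antisymm hle (hQ.2 h.1.1 hle))
      obtain ⟨g, hg, hg'⟩ := SetLike.not_le_iff_exists.1 this
      exact ⟨g, hg', fun _ _ => hg⟩
    · exact ⟨1, fun h1 => hQp.ne_top ((Ideal.eq_top_iff_one _).2 h1),
        fun a b => (h ⟨a, b⟩).elim⟩
  choose g hgQ hgP using hex
  set G := ∏ P ∈ hfin.toFinset, g P with hG
  have hGQ : G ∉ Q := by
    rw [hG, Ideal.IsPrime.prod_mem_iff]
    rintro ⟨P, _, h⟩
    exact hgQ P h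
  have hGP : ∀ P ∈ I.minimalPrimes, P ≠ Q → G ∈ P := fun P hP hne =>
    Ideal.mem_of_dvd _ (Finset.dvd_prod_of_mem g (hfin.mem_toFinset.2 hP)) (hgP P hP hne)
  have hX : ∀ i, X i ∉ I → (X i : MvPolynomial (Fin n) k) ∉ Q := by
    intro i hi hXQ
    have hnz := (hcell i).resolve_left hi
    apply hGQ
    apply hQ.1.2
    apply hnz
    rw [← hrad.radical, ← Ideal.sInf_minimalPrimes, Ideal.mem_sInf]
    intro P hP
    by_cases hPQ : P = Q
    · rw [hPQ]; exact Ideal.mul_mem_right _ _ hXQ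
    · exact Ideal.mul_mem_left _ _ (hGP P hP hPQ)
  set H := G * ∏ i ∈ Finset.univ.filter (fun i => (X i : MvPolynomial (Fin n) k) ∉ I), X i with hH
  have hHQ : H ∉ Q := by
    intro h
    rcases hQp.mem_or_mem h with h | h
    · exact hGQ h
    · rw [Ideal.IsPrime.prod_mem_iff] at h
      obtain ⟨i, hi, h⟩ := h
      exact hX i (Finset.mem_filter.1 hi).2 h
  rw [← MvPolynomial.IsPrime.vanishingIdeal_zeroLocus (K := k) Q, mem_vanishingIdeal_iff] at hHQ
  push Not at hHQ
  obtain ⟨q, hq, hHq⟩ := hHQ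
  rw [hH, map_mul] at hHq
  refine ⟨q, hq, fun i hi => ?_, fun P hP h => ?_⟩
  · have h2 := right_ne_zero_of_mul hHq
    rw [map_prod] at h2
    have := (Finset.prod_ne_zero_iff.1 h2) i (by simpa using hi)
    simpa using this
  · by_contra hne
    exact left_ne_zero_of_mul hHq (h G (hGP P hP hne))

/-- A radical cellular binomial ideal over an algebraically closed field of characteristic
zero is equidimensional: all its minimal primes cut out irreducible components of the same
Krull dimension (equivalently, of the same height). -/
theorem radical_cellular_is_equidimensional
    {k : Type*} [Field k] [IsAlgClosed k] [CharZero k] {n : ℕ}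
    (I : Ideal (MvPolynomial (Fin n) k))
    (hbin : IsBinomialIdeal I) (hcell : IsCellular I) (hrad : I.IsRadical) :
    ∀ P ∈ I.minimalPrimes, ∀ Q ∈ I.minimalPrimes,
      ringKrullDim (MvPolynomial (Fin n) k ⧸ P) =
        ringKrullDim (MvPolynomial (Fin n) k ⧸ Q) := by
  classical
  intro P hP Q hQ
  have hcell' : ∀ i : Fin n, X i ∈ I ∨ ∀ f, X i * f ∈ I → f ∈ I := by
    intro i
    rcases hcell.2 i with h | ⟨m, h⟩
    · exact Or.inr h
    · exact Or.inl (hrad ⟨m, h⟩)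
  obtain ⟨p, hp, hp0, -⟩ := exists_generic_point I hcell' hrad P hP
  obtain ⟨q, hq, hq0, hqu⟩ := exists_generic_point I hcell' hrad Q hQ
  have hpI : ∀ f ∈ I, aeval p f = 0 := fun f hf => hp f (hP.1.2 hf)
  have hqI : ∀ f ∈ I, aeval q f = 0 := fun f hf => hq f (hQ.1.2 hf)
  obtain ⟨l, hl0, hl⟩ : ∃ l : Fin n → k, (∀ i, l i ≠ 0) ∧ ∀ i, l i * p i = q i := by
    refine ⟨fun i => if X i ∈ I then 1 else q i / p i, fun i => ?_, fun i => ?_⟩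
    · by_cases h : X i ∈ I
      · simp [h]
      · simp [h, hp0 i h, hq0 i h]
    · by_cases h : X i ∈ I
      · have h1 := hpI _ h
        have h2 := hqI _ h
        rw [aeval_X] at h1 h2
        simp [h1, h2]
      · simp [h, hp0 i h]
  have hl' : ∀ i, (l⁻¹) i * q i = p i := by
    intro i
    rw [← hl i, Pi.inv_apply, inv_mul_cancel_left₀ (hl0 i)]
  have hc1 : (scaleHom l).comp (scaleHom l⁻¹) = AlgHom.id k _ :=
    scaleHom_scaleHom _ _ fun i => mul_inv_cancel₀ (hl0 i)
  have hc2 : (scaleHom l⁻¹).comp (scaleHom l) = AlgHom.id k _ :=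
    scaleHom_scaleHom _ _ fun i => inv_mul_cancel₀ (hl0 i)
  let e := AlgEquiv.ofAlgHom (scaleHom l) (scaleHom l⁻¹) hc1 hc2
  have hs1 := scaleHom_mem I hbin p q l hpI hqI hp0 hl
  have hs2 := scaleHom_mem I hbin q p l⁻¹ hqI hpI hq0 hl'
  have hcomapI : I.comap (e.toRingEquiv : MvPolynomial (Fin n) k →+* MvPolynomial (Fin n) k) = I := by
    ext f
    rw [Ideal.mem_comap]
    constructor
    · intro h
      have h3 := hs2 _ h
      have h4 : scaleHom l⁻¹ (scaleHom l f) = f := congrArg (fun g => g f) hc2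
      rw [← h4]
      exact h3
    · exact hs1 f
  have hsurj : Function.Surjective (e.toRingEquiv : MvPolynomial (Fin n) k →+* MvPolynomial (Fin n) k) :=
    e.surjective
  have hPc : P.comap (e.toRingEquiv : MvPolynomial (Fin n) k →+* MvPolynomial (Fin n) k) ∈ I.minimalPrimes := by
    have := Ideal.minimalPrimes_comap_of_surjective
      (f := (e.toRingEquiv : MvPolynomial (Fin n) k →+* MvPolynomial (Fin n) k)) hsurj hP
    rwa [hcomapI] at this
  have hPQ : P.comap (e.toRingEquiv : MvPolynomial (Fin n) k →+* MvPolynomial (Fin n) k) = Q := by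
    apply hqu _ hPc
    intro f hf
    rw [← eval_scaleHom l p q hl]
    exact hp _ hf
  symm
  apply ringKrullDim_eq_of_ringEquiv
  refine Ideal.quotientEquiv Q P e.toRingEquiv ?_
  rw [← hPQ, Ideal.map_comap_of_surjective _ hsurj]
end

section
/- Let I ⊆ ℚ[x₁,…,xₙ] be a zero-dimensional pure difference binomial ideal. Then there exists a primitive root of unity ξ_l such that every complex solution of I has all its coordinates in the cyclotomic field ℚ(ξ_l); that is, the (finite) complex variety of I is contained in ℚ(ξ_l)^n. -/
open MvPolynomial

/-- The primitive `l`-th root of unity `ξ_l = exp(2πi/l)` in `ℂ`. -/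
noncomputable def primRoot (l : ℕ) : ℂ :=
  Complex.exp (2 * Real.pi * Complex.I / l)

/-- A pure difference binomial ideal is generated by differences of monic monomials. -/
def IsPureDifferenceIdeal {n : ℕ} (I : Ideal (MvPolynomial (Fin n) ℚ)) : Prop :=
  ∃ S : Set (MvPolynomial (Fin n) ℚ),
    (∀ f ∈ S, ∃ a b : Fin n →₀ ℕ, f = monomial a 1 - monomial b 1) ∧ I = Ideal.span S

/-- If all positive powers of `w` are roots of `p ≠ 0`, then `w = 0` or `w ^ (deg p)! = 1`. -/
lemma aux_pow_eq_one (p : Polynomial ℚ) (hp : p ≠ 0) (w : ℂ)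
    (h : ∀ k : ℕ, Polynomial.aeval (w ^ (k + 1)) p = 0) :
    w = 0 ∨ w ^ (p.natDegree.factorial) = 1 := by
  classical
  by_cases hw : w = 0
  · exact Or.inl hw
  right
  set q := p.map (algebraMap ℚ ℂ) with hq
  have hq0 : q ≠ 0 := Polynomial.map_ne_zero hp
  have hcard : q.roots.toFinset.card < (Finset.range (p.natDegree + 1)).card := by
    have h1 := Multiset.toFinset_card_le q.roots
    have h2 := Polynomial.card_roots' q
    have h3 : q.natDegree = p.natDegree := Polynomial.natDegree_map _
    rw [Finset.card_range]
    omega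
  obtain ⟨a, ha, b, hb, hab, he⟩ :=
    Finset.exists_ne_map_eq_of_card_lt_of_maps_to hcard (f := fun k : ℕ => w ^ (k + 1)) (by
      intro k _
      simp only [Finset.mem_coe, Multiset.mem_toFinset]
      rw [Polynomial.mem_roots hq0, Polynomial.IsRoot, hq, Polynomial.eval_map_algebraMap]
      exact h k)
  have key : ∀ a b : ℕ, b < p.natDegree + 1 → a < b → w ^ (a + 1) = w ^ (b + 1) →
      w ^ (p.natDegree.factorial) = 1 := by
    intro a b hb hab he
    have h1 : w ^ (b - a) = 1 := by
      have : w ^ (b + 1) = w ^ (a + 1) * w ^ (b - a) := by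
        rw [← pow_add]; congr 1; omega
      rw [this] at he
      exact (mul_eq_left₀ (pow_ne_zero _ hw)).1 he.symm
    obtain ⟨c, hc⟩ := Nat.dvd_factorial (show 0 < b - a by omega)
      (show b - a ≤ p.natDegree by omega)
    rw [hc, pow_mul, h1, one_pow]
  simp only [Finset.mem_range] at ha hb
  rcases lt_or_gt_of_ne hab with hlt | hlt
  · exact key a b hb hlt he
  · exact key b a ha hlt he.symm

/-- All complex solutions of a zero-dimensional pure difference binomial ideal lie in a
cyclotomic field `ℚ(ξ_l)`. -/
theorem solutions_of_pure_difference_ideal_in_cyclotomic_field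
    {n : ℕ} (I : Ideal (MvPolynomial (Fin n) ℚ))
    (hpd : IsPureDifferenceIdeal I)
    (hzero : Module.Finite ℚ (MvPolynomial (Fin n) ℚ ⧸ I)) :
    ∃ l : ℕ, 0 < l ∧
      ∀ z : Fin n → ℂ, (∀ f ∈ I, MvPolynomial.aeval z f = 0) →
        ∀ i : Fin n, z i ∈ IntermediateField.adjoin ℚ ({primRoot l} : Set ℂ) := by
  classical
  obtain ⟨S, hS, rfl⟩ := hpd
  have hpow : ∀ z : Fin n → ℂ, (∀ f ∈ Ideal.span S, MvPolynomial.aeval z f = 0) → ∀ k : ℕ,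
      ∀ f ∈ Ideal.span S, MvPolynomial.aeval (fun i => z i ^ k) f = 0 := by
    intro z hz k f hf
    have hle : Ideal.span S ≤
        RingHom.ker (MvPolynomial.aeval (R := ℚ) (fun i => z i ^ k)).toRingHom := by
      rw [Ideal.span_le]
      intro g hg
      have hg0 := hz g (Ideal.subset_span hg)
      obtain ⟨a, b, rfl⟩ := hS g hg
      have hm : ∀ c : Fin n →₀ ℕ, MvPolynomial.aeval (fun i => z i ^ k) (monomial c (1 : ℚ))
          = (MvPolynomial.aeval z (monomial c (1 : ℚ))) ^ k := by
        intro c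
        simp only [MvPolynomial.aeval_monomial, map_one, one_mul, Finsupp.prod, ← Finset.prod_pow]
        exact Finset.prod_congr rfl fun i _ => pow_right_comm _ _ _
      rw [map_sub, sub_eq_zero] at hg0
      change MvPolynomial.aeval (fun i => z i ^ k) (monomial a (1 : ℚ) - monomial b 1) = 0
      rw [map_sub, hm, hm, hg0, sub_self]
    exact hle hf
  have hint : ∀ i : Fin n, ∃ p : Polynomial ℚ, p ≠ 0 ∧
      Polynomial.aeval (X i : MvPolynomial (Fin n) ℚ) p ∈ Ideal.span S := by
    intro i
    obtain ⟨p, hp, hp0⟩ := Algebra.IsIntegral.isIntegral (R := ℚ)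
      (Ideal.Quotient.mkₐ ℚ (Ideal.span S) (X i))
    refine ⟨p, hp.ne_zero, ?_⟩
    rw [← Polynomial.aeval_def, Polynomial.aeval_algHom_apply] at hp0
    exact Ideal.Quotient.eq_zero_iff_mem.1 hp0
  choose p hp0 hp using hint
  have hl : 0 < ∏ i, (p i).natDegree.factorial :=
    Finset.prod_pos fun i _ => Nat.factorial_pos _
  refine ⟨∏ i, (p i).natDegree.factorial, hl, ?_⟩
  intro z hz i
  have hroot := aux_pow_eq_one (p i) (hp0 i) (z i) (by
    intro k
    have := hpow z hz (k + 1) _ (hp i)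
    rw [← Polynomial.aeval_algHom_apply, MvPolynomial.aeval_X] at this
    exact this)
  rcases hroot with h0 | h1
  · rw [h0]; exact zero_mem _
  · have hone : z i ^ (∏ i, (p i).natDegree.factorial) = 1 := by
      obtain ⟨c, hc⟩ := Finset.dvd_prod_of_mem (fun i => (p i).natDegree.factorial)
        (Finset.mem_univ i)
      rw [hc, pow_mul, h1, one_pow]
    generalize (∏ i, (p i).natDegree.factorial) = l at hl hone
    have hprim : IsPrimitiveRoot (primRoot l) l := Complex.isPrimitiveRoot_exp l hl.ne'
    haveI : NeZero l := ⟨hl.ne'⟩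
    obtain ⟨j, _, hj⟩ := hprim.eq_pow_of_pow_eq_one hone
    rw [← hj]
    exact pow_mem (IntermediateField.subset_adjoin ℚ _ (Set.mem_singleton _)) _
end
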